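/- arXiv:1403.0581 — 5 statements merged into one kernel-verified Lean document; each statement's English description precedes it below -/
import Mathlib

section
/- Let R = k[x₁,...,xₙ] be a polynomial ring in n variables over a field k. Every finitely generated R-module M has a finite free resolution of length at most n; that is, there exists an exact sequence 0 → Fₘ → ⋯ → F₁ → F₀ → M → 0 of R-modules in which each Fᵢ is a finitely generated free R-module and m ≤ n. -/
open Polynomial TensorProduct

universe u v

namespace HST

/-- `Res R n M`: `M` has a finite free resolution with at most `n` free modules. -/
def Res (R : Type u) [CommRing R] : ℕ → ∀ (M : Type u) [AddCommGroup M] [Module R M], Prop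
  | 0, M, _, _ => Subsingleton M
  | n + 1, M, _, _ => ∃ (K F : Type u) (_ : AddCommGroup K) (_ : Module R K)
      (_ : AddCommGroup F) (_ : Module R F) (f : K →ₗ[R] F) (g : F →ₗ[R] M),
      Module.Free R F ∧ Module.Finite R F ∧ Function.Injective f ∧ Function.Exact f g ∧
      Function.Surjective g ∧ Res R n K

section basic

variable {R : Type u} [CommRing R]

theorem Res.equiv {n : ℕ} {M N : Type u} [AddCommGroup M] [Module R M] [AddCommGroup N]
    [Module R N] (e : M ≃ₗ[R] N) (h : Res R n M) : Res R n N := by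
  cases n with
  | zero =>
    have : Subsingleton M := h
    exact e.symm.injective.subsingleton
  | succ n =>
    obtain ⟨K, F, _, _, _, _, f, g, h1, h2, h3, h4, h5, h6⟩ := h
    refine ⟨K, F, _, _, _, _, f, e.toLinearMap ∘ₗ g, h1, h2, h3, ?_, e.surjective.comp h5, h6⟩
    intro x
    rw [← h4 x]
    simp

theorem Res.mono {n : ℕ} : ∀ {M : Type u} [AddCommGroup M] [Module R M],
    Res R n M → Res R (n + 1) M := by
  induction n with
  | zero =>
    intro M _ _ h
    have : Subsingleton M := h
    refine ⟨PUnit, PUnit, inferInstance, inferInstance, inferInstance, inferInstance, 0, 0,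
      inferInstance, inferInstance, ?_, ?_, ?_, ?_⟩
    · exact Function.injective_of_subsingleton _
    · intro x
      exact ⟨fun _ => ⟨0, Subsingleton.elim _ _⟩, fun _ => Subsingleton.elim _ _⟩
    · intro x
      exact ⟨0, Subsingleton.elim _ _⟩
    · change Subsingleton PUnit
      infer_instance
  | succ n ih =>
    intro M _ _ h
    obtain ⟨K, F, _, _, _, _, f, g, h1, h2, h3, h4, h5, h6⟩ := h
    exact ⟨K, F, _, _, _, _, f, g, h1, h2, h3, h4, h5, ih h6⟩

theorem Res.of_ker {n : ℕ} {M F : Type u} [AddCommGroup M] [Module R M] [AddCommGroup F]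
    [Module R F] [Module.Free R F] [Module.Finite R F] (g : F →ₗ[R] M)
    (hg : Function.Surjective g) (h : Res R n (LinearMap.ker g)) : Res R (n + 1) M :=
  ⟨LinearMap.ker g, F, _, _, _, _, (LinearMap.ker g).subtype, g, inferInstance, inferInstance,
    Subtype.val_injective, g.exact_subtype_ker_map, hg, h⟩

/-- kernel of second map is the first module -/
noncomputable def kerEquiv {K F M : Type*} [AddCommGroup M] [Module R M] [AddCommGroup F]
    [Module R F] [AddCommGroup K] [Module R K] (f : K →ₗ[R] F) (g : F →ₗ[R] M)
    (hf : Function.Injective f) (h : Function.Exact f g) : K ≃ₗ[R] LinearMap.ker g :=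
  (LinearEquiv.ofInjective f hf).trans
    (LinearEquiv.ofEq _ _ (LinearMap.exact_iff.mp h).symm)

theorem Res.exists_ker {n : ℕ} {M : Type u} [AddCommGroup M] [Module R M]
    (h : Res R (n + 1) M) : ∃ (F : Type u) (_ : AddCommGroup F) (_ : Module R F)
      (g : F →ₗ[R] M), Module.Free R F ∧ Module.Finite R F ∧ Function.Surjective g ∧
      Res R n (LinearMap.ker g) := by
  obtain ⟨K, F, _, _, _, _, f, g, h1, h2, h3, h4, h5, h6⟩ := h
  exact ⟨F, _, _, g, h1, h2, h5, h6.equiv (kerEquiv f g h3 h4)⟩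

theorem Res.horseshoe {n : ℕ} : ∀ {A B C : Type u} [AddCommGroup A] [Module R A]
    [AddCommGroup B] [Module R B] [AddCommGroup C] [Module R C]
    (i : A →ₗ[R] B) (p : B →ₗ[R] C), Function.Injective i → Function.Exact i p →
    Function.Surjective p → Res R n A → Res R n C → Res R n B := by
  induction n with
  | zero =>
    intro A B C _ _ _ _ _ _ i p hi hip hp hA hC
    have : Subsingleton A := hA
    have : Subsingleton C := hC
    refine ⟨fun x y => ?_⟩
    obtain ⟨a, ha⟩ := (hip x).1 (Subsingleton.elim _ _)
    obtain ⟨b, hb⟩ := (hip y).1 (Subsingleton.elim _ _)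
    rw [← ha, ← hb, Subsingleton.elim a b]
  | succ n ih =>
    intro A B C _ _ _ _ _ _ i p hi hip hp hA hC
    obtain ⟨F₁, _, _, g₁, _, _, hg₁, hK₁⟩ := hA.exists_ker
    obtain ⟨F₂, _, _, g₂, _, _, hg₂, hK₂⟩ := hC.exists_ker
    obtain ⟨h, hh⟩ := Module.projective_lifting_property p g₂ hp
    have hh' : ∀ x, p (h x) = g₂ x := fun x => LinearMap.congr_fun hh x
    have hpi : ∀ x, p (i x) = 0 := fun x => hip.apply_apply_eq_zero x
    let φ : F₁ × F₂ →ₗ[R] B := (i ∘ₗ g₁).coprod h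
    have hφ : ∀ x, φ x = i (g₁ x.1) + h x.2 := fun x => by simp [φ]
    refine Res.of_ker φ ?_ ?_
    · intro b
      obtain ⟨y, hy⟩ := hg₂ (p b)
      obtain ⟨a, ha⟩ := (hip (b - h y)).1 (by rw [map_sub, hh', hy, sub_self])
      obtain ⟨x, hx⟩ := hg₁ a
      exact ⟨(x, y), by rw [hφ]; simp [hx, ha]⟩
    · let j : LinearMap.ker g₁ →ₗ[R] LinearMap.ker φ :=
        LinearMap.codRestrict _ (LinearMap.inl R F₁ F₂ ∘ₗ (LinearMap.ker g₁).subtype)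
          (fun x => by
            have := x.2
            rw [LinearMap.mem_ker] at this
            rw [LinearMap.mem_ker, hφ]
            simp [this])
      let q : LinearMap.ker φ →ₗ[R] LinearMap.ker g₂ :=
        LinearMap.codRestrict _ (LinearMap.snd R F₁ F₂ ∘ₗ (LinearMap.ker φ).subtype)
          (fun x => by
            have := x.2
            rw [LinearMap.mem_ker, hφ] at this
            have h2 := congrArg p this
            rw [map_add, hpi, hh', zero_add, map_zero] at h2
            simpa using h2)
      refine ih j q ?_ ?_ ?_ hK₁ hK₂
      · intro x y hxy
        have := congrArg (fun z : LinearMap.ker φ => (z : F₁ × F₂).1) hxy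
        exact Subtype.ext this
      · rintro ⟨⟨x, y⟩, hxy⟩
        constructor
        · intro h0
          have hy : y = 0 := congrArg Subtype.val h0
          subst hy
          rw [LinearMap.mem_ker, hφ] at hxy
          refine ⟨⟨x, ?_⟩, rfl⟩
          rw [LinearMap.mem_ker]
          apply hi
          simpa using hxy
        · rintro ⟨z, hz⟩
          rw [← hz]
          rfl
      · rintro ⟨y, hy⟩
        rw [LinearMap.mem_ker] at hy
        obtain ⟨a, ha⟩ := (hip (h y)).1 (by rw [hh', hy])
        obtain ⟨x, hx⟩ := hg₁ a
        refine ⟨⟨(-x, y), ?_⟩, rfl⟩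
        rw [LinearMap.mem_ker, hφ]
        simp [hx, ha]

theorem Res.cone {n : ℕ} {P Q M : Type u} [AddCommGroup P] [Module R P]
    [AddCommGroup Q] [Module R Q] [AddCommGroup M] [Module R M]
    (i : P →ₗ[R] Q) (p : Q →ₗ[R] M) (hi : Function.Injective i) (hip : Function.Exact i p)
    (hp : Function.Surjective p) (hP : Res R n P) (hQ : Res R n Q) : Res R (n + 1) M := by
  cases n with
  | zero =>
    have : Subsingleton Q := hQ
    exact Res.mono (n := 0) (hp.subsingleton)
  | succ n =>
    have hP' := hP.equiv (kerEquiv i p hi hip)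
    obtain ⟨F, _, _, g, _, _, hg, hK⟩ := hQ.exists_ker
    refine Res.of_ker (p ∘ₗ g) (hp.comp hg) ?_
    let j : LinearMap.ker g →ₗ[R] LinearMap.ker (p ∘ₗ g) :=
      Submodule.inclusion (LinearMap.ker_le_ker_comp g p)
    let q : LinearMap.ker (p ∘ₗ g) →ₗ[R] LinearMap.ker p :=
      LinearMap.codRestrict _ (g ∘ₗ (LinearMap.ker (p ∘ₗ g)).subtype) (fun x => x.2)
    refine Res.horseshoe j q (Submodule.inclusion_injective _) ?_ ?_ hK.mono hP'
    · rintro ⟨x, hx⟩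
      constructor
      · intro h0
        exact ⟨⟨x, congrArg Subtype.val h0⟩, rfl⟩
      · rintro ⟨z, hz⟩
        rw [← hz]
        exact Subtype.ext z.2
    · rintro ⟨y, hy⟩
      obtain ⟨x, hx⟩ := hg y
      exact ⟨⟨x, by subst hx; exact hy⟩, Subtype.ext hx⟩

theorem Res.baseChange {n : ℕ} : ∀ {M : Type u} [AddCommGroup M] [Module R M],
    Res R n M → Res R[X] n (R[X] ⊗[R] M) := by
  induction n with
  | zero =>
    intro M _ _ h
    have : Subsingleton M := h
    change Subsingleton (R[X] ⊗[R] M)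
    infer_instance
  | succ n ih =>
    intro M _ _ h
    obtain ⟨K, F, _, _, _, _, f, g, h1, h2, h3, h4, h5, h6⟩ := h
    exact ⟨R[X] ⊗[R] K, R[X] ⊗[R] F, _, _, _, _, f.baseChange R[X], g.baseChange R[X],
      inferInstance, inferInstance, Module.Flat.lTensor_preserves_injective_linearMap f h3,
      Module.Flat.lTensor_exact _ h4, LinearMap.lTensor_surjective _ h5, ih h6⟩

theorem Res.of_ringEquiv {S : Type u} [CommRing S] (e : R ≃+* S) {n : ℕ} :
    ∀ {M : Type u} [AddCommGroup M] [Module R M] [Module S M],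
    (∀ (r : R) (m : M), e r • m = r • m) → Res S n M → Res R n M := by
  induction n with
  | zero =>
    intro M _ _ _ _ h
    exact h
  | succ n ih =>
    intro M _ _ _ he h
    obtain ⟨K, F, _, _, _, _, f, g, h1, h2, h3, h4, h5, h6⟩ := h
    let mK : Module R K := Module.compHom K e.toRingHom
    let mF : Module R F := Module.compHom F e.toRingHom
    have eK : ∀ (r : R) (m : K), e r • m = r • m := fun _ _ => rfl
    have eF : ∀ (r : R) (m : F), e r • m = r • m := fun _ _ => rfl
    let f' : K →ₗ[R] F := { f with map_smul' := fun r m => by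
                                    change f (r • m) = r • f m
                                    rw [← eK, ← eF, f.map_smul] }
    let g' : F →ₗ[R] M := { g with map_smul' := fun r m => by
                                    change g (r • m) = r • g m
                                    rw [← eF, ← he, g.map_smul] }
    have b : Module.Basis (Module.Free.ChooseBasisIndex S F) R F :=
      (Module.Free.chooseBasis S F).mapCoeffs e.symm (fun s x => by
        rw [← eF, e.apply_symm_apply])
    exact ⟨K, F, _, mK, _, mF, f', g', Module.Free.of_basis b, Module.Finite.of_basis b,
      h3, h4, h5, ih eK h6⟩


theorem Res.extract {n : ℕ} : ∀ {M : Type u} [AddCommGroup M] [Module R M], Res R n M →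
    ∃ (b : ℕ → ℕ) (d : (i : ℕ) → (Fin (b (i + 1)) → R) →ₗ[R] (Fin (b i) → R))
      (ε : (Fin (b 0) → R) →ₗ[R] M),
      Function.Surjective ε ∧
      LinearMap.ker ε = LinearMap.range (d 0) ∧
      (∀ i : ℕ, LinearMap.ker (d i) = LinearMap.range (d (i + 1))) ∧
      (∀ i : ℕ, n ≤ i → b i = 0) := by
  induction n with
  | zero =>
    intro M _ _ h
    have : Subsingleton M := h
    refine ⟨fun _ => 0, fun _ => 0, 0, ?_, ?_, ?_, fun _ _ => rfl⟩
    · intro x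
      exact ⟨0, Subsingleton.elim _ _⟩
    · ext x
      simp [Subsingleton.elim x 0]
    · intro i
      ext x
      simp [Subsingleton.elim x 0]
  | succ n ih =>
    intro M _ _ h
    obtain ⟨K, F, _, _, _, _, f, g, h1, h2, h3, h4, h5, h6⟩ := h
    obtain ⟨b, d, ε, e1, e2, e3, e4⟩ := ih h6
    obtain ⟨r, ⟨e⟩⟩ : ∃ r : ℕ, Nonempty (F ≃ₗ[R] (Fin r → R)) :=
      ⟨_, ⟨((Module.Free.chooseBasis R F).reindex (Fintype.equivFin _)).equivFun⟩⟩
    let b' : ℕ → ℕ := fun i => Nat.casesOn i r b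
    let d' : (i : ℕ) → (Fin (b' (i + 1)) → R) →ₗ[R] (Fin (b' i) → R) := fun i =>
      match i with
      | 0 => e.toLinearMap ∘ₗ f ∘ₗ ε
      | i + 1 => d i
    refine ⟨b', d', g ∘ₗ e.symm.toLinearMap, h5.comp e.symm.surjective, ?_, ?_, ?_⟩
    · change LinearMap.ker (g ∘ₗ e.symm.toLinearMap) = LinearMap.range (e.toLinearMap ∘ₗ f ∘ₗ ε)
      ext x
      rw [LinearMap.mem_ker, LinearMap.comp_apply, h4]
      constructor
      · rintro ⟨y, hy⟩
        obtain ⟨z, rfl⟩ := e1 y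
        exact ⟨z, by simp [hy]⟩
      · rintro ⟨z, hz⟩
        exact ⟨ε z, by simp [← hz]⟩
    · intro i
      cases i with
      | zero =>
        change LinearMap.ker (e.toLinearMap ∘ₗ f ∘ₗ ε) = LinearMap.range (d 0)
        rw [← e2]
        ext x
        simp [map_eq_zero_iff f h3]
      | succ i => exact e3 i
    · intro i hi
      cases i with
      | zero => omega
      | succ i => exact e4 i (by omega)

end basic

section filtration

variable {A : Type u} [CommRing A] {M : Type u} [AddCommGroup M] [Module A[X] M] [Module A M]
  [IsScalarTower A A[X] M]

/-- multiplication by `X` as an `A`-linear map -/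
noncomputable def mulX (A : Type u) [CommRing A] (M : Type u) [AddCommGroup M] [Module A[X] M]
    [Module A M] [IsScalarTower A A[X] M] : M →ₗ[A] M := Algebra.lsmul A A M (X : A[X])

@[simp] theorem mulX_apply (m : M) : mulX A M m = (X : A[X]) • m := rfl

/-- The filtration `M₀ + X M₀ + ... + X^i M₀`. -/
noncomputable def fil (M₀ : Submodule A M) : ℕ → Submodule A M
  | 0 => M₀
  | i + 1 => fil M₀ i ⊔ (fil M₀ i).map (mulX A M)

variable (M₀ : Submodule A M)

theorem fil_succ (i : ℕ) : fil M₀ (i + 1) = fil M₀ i ⊔ (fil M₀ i).map (mulX A M) := rfl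

theorem fil_mono : Monotone (fil M₀) := monotone_nat_of_le_succ fun _ => le_sup_left

theorem X_smul_mem {i : ℕ} {m : M} (h : m ∈ fil M₀ i) : (X : A[X]) • m ∈ fil M₀ (i + 1) :=
  Submodule.mem_sup_right ⟨m, h, rfl⟩

theorem X_pow_smul_mem {i : ℕ} {m : M} (h : m ∈ fil M₀ i) (j : ℕ) :
    (X ^ j : A[X]) • m ∈ fil M₀ (i + j) := by
  induction j with
  | zero => simpa using h
  | succ j ih =>
    rw [pow_succ', mul_smul]
    exact X_smul_mem M₀ ih

theorem fil_fg (h : M₀.FG) (i : ℕ) : (fil M₀ i).FG := by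
  induction i with
  | zero => exact h
  | succ i ih => exact ih.sup (ih.map _)

theorem fil_decomp (i : ℕ) : ∀ m ∈ fil M₀ (i + 1), ∃ a ∈ M₀, ∃ c ∈ fil M₀ i,
    m = (X ^ (i + 1) : A[X]) • a + c := by
  induction i with
  | zero =>
    intro m hm
    obtain ⟨c, hc, _, ⟨a, ha, rfl⟩, rfl⟩ := Submodule.mem_sup.1 hm
    exact ⟨a, ha, c, hc, by simp [add_comm]⟩
  | succ i ih =>
    intro m hm
    obtain ⟨c, hc, _, ⟨b, hb, rfl⟩, rfl⟩ := Submodule.mem_sup.1 hm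
    obtain ⟨a, ha, c', hc', rfl⟩ := ih b hb
    refine ⟨a, ha, c + (X : A[X]) • c', add_mem hc (X_smul_mem M₀ hc'), ?_⟩
    rw [mulX_apply, smul_add, ← mul_smul, ← pow_succ']
    abel

theorem exists_bound [IsNoetherianRing A] (h : M₀.FG) : ∃ d, ∀ i, d ≤ i → ∀ m ∈ fil M₀ (i + 1),
    (X : A[X]) • m ∈ fil M₀ (i + 1) → m ∈ fil M₀ i := by
  have : Module.Finite A M₀ := Module.Finite.iff_fg.2 h
  have hN : IsNoetherian A M₀ := inferInstance
  let N : ℕ →o Submodule A M₀ :=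
    ⟨fun i => (fil M₀ i).comap (((mulX A M) ^ (i + 1)) ∘ₗ M₀.subtype),
      monotone_nat_of_le_succ fun i m hm => by
        simp only [Submodule.mem_comap, LinearMap.comp_apply] at hm ⊢
        rw [pow_succ', Module.End.mul_apply]
        exact X_smul_mem M₀ hm⟩
  have hmem : ∀ i (m : M₀), m ∈ N i ↔ (X ^ (i + 1) : A[X]) • (m : M) ∈ fil M₀ i := by
    intro i m
    have : ∀ j (m : M), (mulX A M ^ j) m = (X ^ j : A[X]) • m := by
      intro j
      induction j with
      | zero => simp
      | succ j ih => intro m; rw [pow_succ', Module.End.mul_apply, ih, mulX_apply, pow_succ', mul_smul]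
    change (mulX A M ^ (i + 1)) (m : M) ∈ fil M₀ i ↔ _
    rw [this]
  obtain ⟨d, hd⟩ := monotone_stabilizes_iff_noetherian.2 hN N
  refine ⟨d, fun i hi m hm hX => ?_⟩
  obtain ⟨a, ha, c, hc, rfl⟩ := fil_decomp M₀ i m hm
  have h1 : (X ^ (i + 1 + 1) : A[X]) • a ∈ fil M₀ (i + 1) := by
    rw [smul_add, ← mul_smul, ← pow_succ'] at hX
    exact (Submodule.add_mem_iff_left _ (X_smul_mem M₀ hc)).1 hX
  have h2 : (⟨a, ha⟩ : M₀) ∈ N (i + 1) := (hmem _ _).2 h1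
  rw [← hd (i + 1) (by omega), hd i hi, hmem] at h2
  exact add_mem h2 hc

theorem mem_of_pow {d : ℕ} (hd : ∀ i, d ≤ i → ∀ m ∈ fil M₀ (i + 1),
    (X : A[X]) • m ∈ fil M₀ (i + 1) → m ∈ fil M₀ i) (j : ℕ) (m : M) (hm : m ∈ fil M₀ (d + 1))
    (h : (X ^ (j + 1) : A[X]) • m ∈ fil M₀ (d + 1 + j)) : m ∈ fil M₀ d := by
  induction j with
  | zero => exact hd d le_rfl m hm (by simpa using h)
  | succ j ih =>
    apply ih
    refine hd (d + 1 + j) (by omega) _ ?_ ?_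
    · exact X_pow_smul_mem M₀ hm (j + 1)
    · rw [← mul_smul, ← pow_succ']
      exact h

theorem fil_exhaust (h : Submodule.span A[X] (M₀ : Set M) = ⊤) (m : M) : ∃ i, m ∈ fil M₀ i := by
  have hm : m ∈ Submodule.span A[X] (M₀ : Set M) := h ▸ Submodule.mem_top
  have hadd : ∀ x y : M, (∃ i, x ∈ fil M₀ i) → (∃ i, y ∈ fil M₀ i) → ∃ i, x + y ∈ fil M₀ i := by
    rintro x y ⟨i, hi⟩ ⟨j, hj⟩
    exact ⟨max i j, add_mem (fil_mono M₀ (le_max_left _ _) hi)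
      (fil_mono M₀ (le_max_right _ _) hj)⟩
  induction hm using Submodule.span_induction with
  | mem x hx => exact ⟨0, hx⟩
  | zero => exact ⟨0, zero_mem _⟩
  | add x y _ _ hx hy => exact hadd x y hx hy
  | smul p x _ hx =>
    induction p using Polynomial.induction_on' with
    | add p q hp hq => rw [add_smul]; exact hadd _ _ hp hq
    | monomial n a =>
      obtain ⟨i, hi⟩ := hx
      refine ⟨i + n, ?_⟩
      rw [← mul_one a, ← smul_eq_mul, ← smul_monomial, smul_assoc, monomial_one_right_eq_X_pow]
      exact Submodule.smul_mem _ _ (X_pow_smul_mem M₀ hi n)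

end filtration

section exactness

variable {A : Type u} [CommRing A]

/-- `PolynomialModule.map` as an `A[X]`-linear map. -/
noncomputable def pmap {P Q : Type u} [AddCommGroup P] [Module A P] [AddCommGroup Q] [Module A Q]
    (f : P →ₗ[A] Q) : PolynomialModule A P →ₗ[A[X]] PolynomialModule A Q :=
  { PolynomialModule.map A f with
    map_smul' := fun p q => by
      have := PolynomialModule.map_smul A f p q
      simpa using this }

theorem pmap_coeff {P Q : Type u} [AddCommGroup P] [Module A P] [AddCommGroup Q] [Module A Q]
    (f : P →ₗ[A] Q) (p : PolynomialModule A P) (n : ℕ) :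
    (pmap f p).coeff n = f (p.coeff n) := rfl

/-- `X • incl - shift` -/
noncomputable def alpha {P Q : Type u} [AddCommGroup P] [Module A P] [AddCommGroup Q] [Module A Q]
    (i s : P →ₗ[A] Q) : PolynomialModule A P →ₗ[A[X]] PolynomialModule A Q :=
  (X : A[X]) • pmap i - pmap s

theorem X_smul_coeff_succ {Q : Type u} [AddCommGroup Q] [Module A Q] (q : PolynomialModule A Q)
    (n : ℕ) : ((X : A[X]) • q).coeff (n + 1) = q.coeff n := by
  rw [← monomial_one_one_eq_X, PolynomialModule.monomial_smul_apply]
  simp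

theorem coeff_sub' {Q : Type u} [AddCommGroup Q] [Module A Q] (p q : PolynomialModule A Q) (n : ℕ) :
    (p - q).coeff n = p.coeff n - q.coeff n := rfl

theorem alpha_coeff_succ {P Q : Type u} [AddCommGroup P] [Module A P] [AddCommGroup Q] [Module A Q]
    (i s : P →ₗ[A] Q) (p : PolynomialModule A P) (n : ℕ) :
    (alpha i s p).coeff (n + 1) = i (p.coeff n) - s (p.coeff (n + 1)) := by
  rw [alpha, LinearMap.sub_apply, LinearMap.smul_apply, coeff_sub', X_smul_coeff_succ,
    pmap_coeff, pmap_coeff]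

theorem exists_deg {Q : Type u} [AddCommGroup Q] [Module A Q] (q : PolynomialModule A Q) :
    ∃ N, ∀ n, N ≤ n → q.coeff n = 0 := by
  refine ⟨q.coeff.support.sup id + 1, fun n hn => ?_⟩
  by_contra h
  have := Finset.le_sup (f := id) (Finsupp.mem_support_iff.2 h)
  simp only [id] at this
  omega

theorem alpha_injective {P Q : Type u} [AddCommGroup P] [Module A P] [AddCommGroup Q] [Module A Q]
    (i s : P →ₗ[A] Q) (hi : Function.Injective i) : Function.Injective (alpha i s) := by
  rw [injective_iff_map_eq_zero]
  intro p hp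
  have key : ∀ n, p.coeff (n + 1) = 0 → p.coeff n = 0 := by
    intro n hn
    have := alpha_coeff_succ i s p n
    rw [hp, hn, map_zero, sub_zero] at this
    exact hi (by rw [← this]; simp)
  obtain ⟨N, hN⟩ := exists_deg p
  have : ∀ N, (∀ n, N ≤ n → p.coeff n = 0) → p = 0 := by
    intro N
    induction N with
    | zero => intro h; ext n; exact h n (Nat.zero_le _)
    | succ N ih =>
      intro h
      apply ih
      intro n hn
      rcases hn.eq_or_lt with rfl | hn
      · exact key _ (h _ le_rfl)
      · exact h n hn
  exact this N hN

theorem alpha_single {P Q : Type u} [AddCommGroup P] [Module A P] [AddCommGroup Q] [Module A Q]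
    (i s : P →ₗ[A] Q) (n : ℕ) (p : P) : alpha i s (PolynomialModule.single A n p) =
    PolynomialModule.single A (n + 1) (i p) - PolynomialModule.single A n (s p) := by
  have : ∀ f : P →ₗ[A] Q, pmap f (PolynomialModule.single A n p) =
    PolynomialModule.single A n (f p) := fun f => PolynomialModule.map_single A f n p
  rw [alpha, LinearMap.sub_apply, LinearMap.smul_apply, this, this, ← monomial_one_one_eq_X,
    PolynomialModule.monomial_smul_single, one_smul, add_comm]

variable {M : Type u} [AddCommGroup M] [Module A[X] M] [Module A M] [IsScalarTower A A[X] M]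

/-- evaluation map `Q[X] → M` for a submodule `Q` of `M` -/
noncomputable def beta (Q : Submodule A M) : PolynomialModule A Q →ₗ[A[X]] M :=
  (Q.subtype.liftBaseChange A[X]) ∘ₗ
    (PolynomialModule.polynomialTensorProductLEquivPolynomialModule A Q).symm.toLinearMap

theorem beta_single (Q : Submodule A M) (n : ℕ) (q : Q) :
    beta Q (PolynomialModule.single A n q) = (X ^ n : A[X]) • (q : M) := by
  have : (PolynomialModule.polynomialTensorProductLEquivPolynomialModule A Q).symm
      (PolynomialModule.single A n q) = (X ^ n : A[X]) ⊗ₜ[A] q := by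
    rw [LinearEquiv.symm_apply_eq]
    change _ = LinearMap.liftBaseChange A[X] (PolynomialModule.lsingle A 0) _
    rw [LinearMap.liftBaseChange_tmul, ← monomial_one_right_eq_X_pow,
      PolynomialModule.monomial_smul_lsingle, one_smul]
    rfl
  rw [beta, LinearMap.comp_apply, LinearEquiv.coe_coe, this, LinearMap.liftBaseChange_tmul]
  rfl

variable (M₀ : Submodule A M)

/-- inclusion -/
noncomputable def inc (d : ℕ) : fil M₀ d →ₗ[A] fil M₀ (d + 1) :=
  Submodule.inclusion (fil_mono M₀ (Nat.le_succ d))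

/-- multiplication by `X` -/
noncomputable def shf (d : ℕ) : fil M₀ d →ₗ[A] fil M₀ (d + 1) :=
  LinearMap.codRestrict _ (mulX A M ∘ₗ (fil M₀ d).subtype) (fun x => X_smul_mem M₀ x.2)

theorem beta_alpha (d : ℕ) (p : PolynomialModule A (fil M₀ d)) :
    beta (fil M₀ (d + 1)) (alpha (inc M₀ d) (shf M₀ d) p) = 0 := by
  induction p using PolynomialModule.induction_linear with
  | zero => simp
  | add p q hp hq => rw [map_add, map_add, hp, hq, add_zero]
  | single n m =>
    rw [alpha_single, map_sub, beta_single, beta_single, sub_eq_zero, pow_succ, mul_smul]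
    rfl

theorem split_top {Q : Type u} [AddCommGroup Q] [Module A Q] (q : PolynomialModule A Q) (N : ℕ)
    (h : ∀ n, N + 1 ≤ n → q.coeff n = 0) :
    ∃ q' : PolynomialModule A Q, (∀ n, N ≤ n → q'.coeff n = 0) ∧
      q = q' + PolynomialModule.single A N (q.coeff N) := by
  refine ⟨q - PolynomialModule.single A N (q.coeff N), fun n hn => ?_, by simp⟩
  rw [coeff_sub', PolynomialModule.coeff_single]
  rcases hn.eq_or_lt with rfl | hn
  · simp
  · rw [h n hn, Finsupp.single_eq_of_ne (by omega), sub_zero]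

theorem beta_mem (d N : ℕ) : ∀ (q : PolynomialModule A (fil M₀ d)),
    (∀ n, N + 1 ≤ n → q.coeff n = 0) → beta (fil M₀ d) q ∈ fil M₀ (d + N) := by
  induction N with
  | zero =>
    intro q hq
    obtain ⟨q', h, e⟩ := split_top q 0 hq
    have : q' = 0 := by ext n; exact congrArg _ (h n (Nat.zero_le _))
    rw [e, this, zero_add, beta_single]
    simp
  | succ N ih =>
    intro q hq
    obtain ⟨q', h, e⟩ := split_top q (N + 1) hq
    rw [e, map_add, beta_single]
    exact add_mem (fil_mono M₀ (by omega) (ih q' h)) (X_pow_smul_mem M₀ (Subtype.property _) _)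

theorem mem_range_alpha {d : ℕ} (hd : ∀ i, d ≤ i → ∀ m ∈ fil M₀ (i + 1),
    (X : A[X]) • m ∈ fil M₀ (i + 1) → m ∈ fil M₀ i) (N : ℕ) :
    ∀ (q : PolynomialModule A (fil M₀ (d + 1))), (∀ n, N ≤ n → q.coeff n = 0) →
      beta _ q = 0 → q ∈ LinearMap.range (alpha (inc M₀ d) (shf M₀ d)) := by
  induction N with
  | zero =>
    intro q hq _
    have : q = 0 := by ext n; exact congrArg _ (hq n (Nat.zero_le _))
    rw [this]
    exact zero_mem _
  | succ N ih =>
    intro q hq h0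
    obtain ⟨q', h, e⟩ := split_top q N hq
    cases N with
    | zero =>
      have : q' = 0 := by ext n; exact congrArg _ (h n (Nat.zero_le _))
      rw [this, zero_add] at e
      rw [e, beta_single] at h0
      have h1 : q.coeff 0 = 0 := by simpa using h0
      rw [e, h1]
      simp
    | succ N =>
      have h1 : (X ^ (N + 1) : A[X]) • (q.coeff (N + 1) : M) ∈ fil M₀ (d + 1 + N) := by
        rw [e, map_add, beta_single] at h0
        rw [eq_neg_of_add_eq_zero_right h0]
        exact neg_mem (beta_mem M₀ (d + 1) N q' h)
      have h2 := mem_of_pow M₀ hd N _ (q.coeff (N + 1)).2 h1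
      let p : PolynomialModule A (fil M₀ d) := PolynomialModule.single A N ⟨_, h2⟩
      have h3 : q - alpha (inc M₀ d) (shf M₀ d) p ∈
          LinearMap.range (alpha (inc M₀ d) (shf M₀ d)) := by
        apply ih
        · intro n hn
          rw [alpha_single]
          have : inc M₀ d ⟨_, h2⟩ = q.coeff (N + 1) := rfl
          rw [this]
          nth_rw 1 [e]
          rw [coeff_sub', coeff_sub', PolynomialModule.coeff_add, Finsupp.add_apply, h n hn,
            PolynomialModule.coeff_single, PolynomialModule.coeff_single,
            Finsupp.single_eq_of_ne (a := N) (by omega)]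
          simp
        · rw [map_sub, h0, beta_alpha, sub_zero]
      have h4 := add_mem h3 (LinearMap.mem_range_self (alpha (inc M₀ d) (shf M₀ d)) p)
      rwa [sub_add_cancel] at h4

theorem beta_surjective (d : ℕ) (h : Submodule.span A[X] (M₀ : Set M) = ⊤) :
    Function.Surjective (beta (fil M₀ d)) := by
  rw [← LinearMap.range_eq_top, eq_top_iff, ← h, Submodule.span_le]
  intro m hm
  refine ⟨PolynomialModule.single A 0 ⟨m, fil_mono M₀ (Nat.zero_le d) hm⟩, ?_⟩
  rw [beta_single]
  simp

end exactness

theorem res_polynomial {A : Type u} [CommRing A] [IsNoetherianRing A] (n : ℕ)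
    (hA : ∀ (N : Type u) [AddCommGroup N] [Module A N] [Module.Finite A N], Res A n N)
    (M : Type u) [AddCommGroup M] [Module A[X] M] [Module.Finite A[X] M] : Res A[X] (n + 1) M := by
  let _ : Module A M := Module.compHom M (C : A →+* A[X])
  have : IsScalarTower A A[X] M := ⟨fun a p m => by
    change (a • p) • m = C a • (p • m)
    rw [smul_smul, smul_eq_C_mul]⟩
  obtain ⟨S, hS⟩ := (Module.Finite.fg_top : (⊤ : Submodule A[X] M).FG)
  let M₀ : Submodule A M := Submodule.span A (S : Set M)
  have hM₀ : M₀.FG := ⟨S, rfl⟩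
  have hspan : Submodule.span A[X] (M₀ : Set M) = ⊤ := by
    rw [eq_top_iff, ← hS]
    exact Submodule.span_mono Submodule.subset_span
  obtain ⟨d, hd⟩ := exists_bound M₀ hM₀
  have hres : ∀ i, Res A[X] n (PolynomialModule A (fil M₀ i)) := fun i => by
    have : Module.Finite A (fil M₀ i) := Module.Finite.iff_fg.2 (fil_fg M₀ hM₀ i)
    exact (Res.baseChange (hA (fil M₀ i))).equiv
      (PolynomialModule.polynomialTensorProductLEquivPolynomialModule A (fil M₀ i))
  refine Res.cone (alpha (inc M₀ d) (shf M₀ d)) (beta (fil M₀ (d + 1)))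
    (alpha_injective _ _ (Submodule.inclusion_injective _)) ?_ (beta_surjective M₀ _ hspan)
    (hres _) (hres _)
  intro q
  constructor
  · intro h
    obtain ⟨N, hN⟩ := exists_deg q
    exact mem_range_alpha M₀ hd N q hN h
  · rintro ⟨p, rfl⟩
    exact beta_alpha M₀ d p

theorem res_transfer {R S : Type u} [CommRing R] [CommRing S] (e : R ≃+* S) (n : ℕ)
    (hS : ∀ (N : Type u) [AddCommGroup N] [Module S N] [Module.Finite S N], Res S n N)
    (M : Type u) [AddCommGroup M] [Module R M] [Module.Finite R M] : Res R n M := by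
  let _ : Module S M := Module.compHom M e.symm.toRingHom
  have he : ∀ (r : R) (m : M), e r • m = r • m := fun r m => by
    change (e.symm (e r)) • m = r • m
    rw [e.symm_apply_apply]
  have : Module.Finite S M := by
    obtain ⟨T, hT⟩ := (Module.Finite.fg_top : (⊤ : Submodule R M).FG)
    refine ⟨⟨T, ?_⟩⟩
    rw [eq_top_iff]
    intro m _
    have hm : m ∈ Submodule.span R (T : Set M) := hT ▸ Submodule.mem_top
    induction hm using Submodule.span_induction with
    | mem x hx => exact Submodule.subset_span hx
    | zero => exact zero_mem _
    | add x y _ _ hx hy => exact add_mem (hx trivial) (hy trivial)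
    | smul r x _ hx => rw [← he]; exact Submodule.smul_mem _ _ (hx trivial)
  exact Res.of_ringEquiv e he (hS M)

theorem res_field (k : Type u) [Field k] (M : Type u) [AddCommGroup M] [Module k M]
    [Module.Finite k M] : Res k 1 M := by
  refine Res.of_ker (LinearMap.id : M →ₗ[k] M) Function.surjective_id ?_
  change Subsingleton _
  rw [LinearMap.ker_id]
  infer_instance

theorem res_mvPolynomial (k : Type u) [Field k] (n : ℕ) :
    ∀ (M : Type u) [AddCommGroup M] [Module (MvPolynomial (Fin n) k) M]
      [Module.Finite (MvPolynomial (Fin n) k) M], Res (MvPolynomial (Fin n) k) (n + 1) M := by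
  induction n with
  | zero => exact res_transfer (MvPolynomial.isEmptyRingEquiv k (Fin 0)) 1 (res_field k)
  | succ n ih =>
    exact res_transfer (MvPolynomial.finSuccEquiv k n).toRingEquiv (n + 2)
      (res_polynomial (n + 1) ih)

end HST


/-- **Hilbert's Syzygy Theorem.** Let `R = k[x₁,...,xₙ]` be a polynomial ring in `n`
variables over a field `k`. Every finitely generated `R`-module `M` has a finite free
resolution of length at most `n`: there are finitely generated free modules
`Fᵢ = R^{b i}` (with `Fᵢ = 0` for `i > n`, encoding length `m ≤ n`), maps
`d i : F (i+1) → F i` and `ε : F 0 → M` such that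
`0 → Fₘ → ⋯ → F₁ → F₀ → M → 0` is exact. -/
theorem hilbert_syzygy_theorem (k : Type*) [Field k] (n : ℕ)
    (M : Type*) [AddCommGroup M] [Module (MvPolynomial (Fin n) k) M]
    [Module.Finite (MvPolynomial (Fin n) k) M] :
    ∃ (b : ℕ → ℕ)
      (d : (i : ℕ) → (Fin (b (i + 1)) → MvPolynomial (Fin n) k) →ₗ[MvPolynomial (Fin n) k]
        (Fin (b i) → MvPolynomial (Fin n) k))
      (ε : (Fin (b 0) → MvPolynomial (Fin n) k) →ₗ[MvPolynomial (Fin n) k] M),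
      Function.Surjective ε ∧
      LinearMap.ker ε = LinearMap.range (d 0) ∧
      (∀ i : ℕ, LinearMap.ker (d i) = LinearMap.range (d (i + 1))) ∧
      (∀ i : ℕ, n < i → b i = 0) := by
  obtain ⟨r, π, hπ⟩ := Module.Finite.exists_fin' (MvPolynomial (Fin n) k) M
  let e := LinearMap.quotKerEquivOfSurjective π hπ
  obtain ⟨b, d, ε, h1, h2, h3, h4⟩ := (HST.res_mvPolynomial k n
    ((Fin r → MvPolynomial (Fin n) k) ⧸ LinearMap.ker π)).extract
  refine ⟨b, d, e.toLinearMap ∘ₗ ε, e.surjective.comp h1, ?_, h3, fun i hi => h4 i hi⟩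
  rw [← h2]
  ext x
  simp
end

section
/- (Buchberger's Criterion.) Let > be a global monomial order on R = k[x₁,...,xₙ] and let f₁,...,f_r ∈ R be nonzero polynomials. For i = 1,...,r set Mᵢ := ⟨L(f₁),...,L(f_{i−1})⟩ : L(fᵢ), and for each minimal monomial generator x^α of Mᵢ let h^{(i,α)} be the remainder of x^α fᵢ upon division by f₁,...,f_r (in this order). Then f₁,...,f_r form a Gröbner basis if and only if all the remainders h^{(i,α)} are zero. -/
open MvPolynomial

/-- A global monomial order on `k[x₁,...,xₙ]`: a total order on the monomials
(identified with their exponent vectors in `Fin n →₀ ℕ`) such that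
`x^α > x^β` implies `x^γ x^α > x^γ x^β`, and `xᵢ > 1` for all `i`. -/
structure MonomialOrd (n : ℕ) where
  lt : (Fin n →₀ ℕ) → (Fin n →₀ ℕ) → Prop
  trichotomy : ∀ a b, lt a b ∨ a = b ∨ lt b a
  lt_trans : ∀ a b c, lt a b → lt b c → lt a c
  lt_irrefl : ∀ a, ¬ lt a a
  add_right : ∀ a b c, lt a b → lt (a + c) (b + c)
  var_pos : ∀ i : Fin n, lt 0 (Finsupp.single i 1)

/-- `x^a` divides `x^b`. -/
def MonDvd {n : ℕ} (a b : Fin n →₀ ℕ) : Prop := ∃ c, b = a + c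

variable {k : Type*} [Field k] {n : ℕ}

/-- `β` is the exponent of the leading monomial of `f` w.r.t. `μ`. -/
def IsLeadMon (μ : MonomialOrd n) (f : MvPolynomial (Fin n) k) (β : Fin n →₀ ℕ) : Prop :=
  β ∈ f.support ∧ ∀ γ ∈ f.support, γ ≠ β → μ.lt γ β

/-- The exponent of the leading monomial of `f` (junk value `0` if `f = 0`). -/
noncomputable def leadMon (μ : MonomialOrd n) (f : MvPolynomial (Fin n) k) : Fin n →₀ ℕ :=
  letI := Classical.propDecidable (∃ β, IsLeadMon μ f β)
  if h : ∃ β, IsLeadMon μ f β then h.choose else 0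

/-- The leading term `L(f)` of `f`; by convention `L(0) = 0`. -/
noncomputable def leadTerm (μ : MonomialOrd n) (f : MvPolynomial (Fin n) k) :
    MvPolynomial (Fin n) k :=
  monomial (leadMon μ f) (coeff (leadMon μ f) f)

/-- `g = q₁ f₁ + ⋯ + q_r f_r + h` where (2a) no term of `qᵢ · L(fᵢ)` is divisible by
`L(f_j)` for `j < i`, and (2b) no term of `h` is divisible by any `L(fᵢ)`. -/
def IsDivisionExpr (μ : MonomialOrd n) {r : ℕ} (f : Fin r → MvPolynomial (Fin n) k)
    (g : MvPolynomial (Fin n) k) (q : Fin r → MvPolynomial (Fin n) k)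
    (h : MvPolynomial (Fin n) k) : Prop :=
  g = (∑ i, q i * f i) + h ∧
    (∀ i : Fin r, ∀ γ ∈ (q i).support, ∀ j, j < i →
      ¬ MonDvd (leadMon μ (f j)) (γ + leadMon μ (f i))) ∧
    (∀ γ ∈ h.support, ∀ i, ¬ MonDvd (leadMon μ (f i)) γ)

/-- `h` is the remainder of `g` upon division by `f₁,...,f_r` (in this order). -/
def IsRemainder (μ : MonomialOrd n) {r : ℕ} (f : Fin r → MvPolynomial (Fin n) k)
    (g h : MvPolynomial (Fin n) k) : Prop :=
  ∃ q, IsDivisionExpr μ f g q h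

/-- `f₁,...,f_r` is a Gröbner basis: the ideal generated by the leading terms of all
elements of `⟨f₁,...,f_r⟩` equals `⟨L(f₁),...,L(f_r)⟩`. -/
def IsGroebner (μ : MonomialOrd n) {r : ℕ} (f : Fin r → MvPolynomial (Fin n) k) : Prop :=
  Ideal.span {p | ∃ g ∈ Ideal.span (Set.range f), p = leadTerm μ g} =
    Ideal.span (Set.range fun i => leadTerm μ (f i))

/-- The colon ideal `Mᵢ = ⟨L(f₁),...,L(f_{i-1})⟩ : L(fᵢ)`. -/
noncomputable def colonIdeal (μ : MonomialOrd n) {r : ℕ}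
    (f : Fin r → MvPolynomial (Fin n) k) (i : Fin r) : Ideal (MvPolynomial (Fin n) k) :=
  Submodule.colon (Ideal.span {p | ∃ j, j < i ∧ p = leadTerm μ (f j)})
    (Ideal.span {leadTerm μ (f i)})

/-- `x^α` is a minimal monomial generator of the monomial ideal `I`. -/
def IsMinGen (I : Ideal (MvPolynomial (Fin n) k)) (α : Fin n →₀ ℕ) : Prop :=
  monomial α (1 : k) ∈ I ∧ ∀ β, MonDvd β α → β ≠ α → monomial β (1 : k) ∉ I

/-- A global monomial order on the free module `R^r`: a total order on the monomials
`x^α eᵢ` (identified with pairs `(α, i)`) such that `x^α eᵢ > x^β e_j` implies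
`x^γ x^α eᵢ > x^γ x^β e_j`, and `x^α eᵢ > eᵢ` for all `i` and `α ≠ 0`. -/
structure VecMonomialOrd (n r : ℕ) where
  lt : (Fin n →₀ ℕ) × Fin r → (Fin n →₀ ℕ) × Fin r → Prop
  trichotomy : ∀ a b, lt a b ∨ a = b ∨ lt b a
  lt_trans : ∀ a b c, lt a b → lt b c → lt a c
  lt_irrefl : ∀ a, ¬ lt a a
  add_left : ∀ (γ : Fin n →₀ ℕ) a b, lt a b → lt (γ + a.1, a.2) (γ + b.1, b.2)
  pos : ∀ (α : Fin n →₀ ℕ) (i : Fin r), α ≠ 0 → lt (0, i) (α, i)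

/-- The module monomial `x^{a.1} e_{a.2}` divides (has as a multiple) `x^{b.1} e_{b.2}`. -/
def VecMonDvd {n r : ℕ} (a b : (Fin n →₀ ℕ) × Fin r) : Prop :=
  a.2 = b.2 ∧ MonDvd a.1 b.1

/-- `m = (β, c)` is the leading monomial `x^β e_c` of the vector `F ∈ R^{r₀}`
w.r.t. the order `lt` on module monomials. -/
def IsLeadMonV {r₀ : ℕ} (lt : (Fin n →₀ ℕ) × Fin r₀ → (Fin n →₀ ℕ) × Fin r₀ → Prop)
    (F : Fin r₀ → MvPolynomial (Fin n) k) (m : (Fin n →₀ ℕ) × Fin r₀) : Prop :=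
  m.1 ∈ (F m.2).support ∧
    ∀ γ (i : Fin r₀), γ ∈ (F i).support → (γ, i) ≠ m → lt (γ, i) m

/-- The vector `c · x^{m.1} e_{m.2} ∈ R^{r₀}`. -/
noncomputable def vecTerm {r₀ : ℕ} (m : (Fin n →₀ ℕ) × Fin r₀) (c : k) :
    Fin r₀ → MvPolynomial (Fin n) k :=
  Pi.single m.2 (monomial m.1 c)

/-- The leading term of `F`, given its leading monomial `m`. -/
noncomputable def leadTermV {r₀ : ℕ} (F : Fin r₀ → MvPolynomial (Fin n) k)
    (m : (Fin n →₀ ℕ) × Fin r₀) : Fin r₀ → MvPolynomial (Fin n) k :=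
  vecTerm m (coeff m.1 (F m.2))

/-- `F₁,...,F_{r₁}` is a Gröbner basis in `R^{r₀}`: the submodule generated by the leading
terms of all elements of `⟨F₁,...,F_{r₁}⟩` equals `⟨L(F₁),...,L(F_{r₁})⟩`. -/
def IsGroebnerV {r₀ r₁ : ℕ} (μ : VecMonomialOrd n r₀)
    (F : Fin r₁ → (Fin r₀ → MvPolynomial (Fin n) k)) : Prop :=
  Submodule.span (MvPolynomial (Fin n) k)
      {v | ∃ G ∈ Submodule.span (MvPolynomial (Fin n) k) (Set.range F),
        ∃ m, IsLeadMonV μ.lt G m ∧ v = leadTermV G m} =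
    Submodule.span (MvPolynomial (Fin n) k)
      {v | ∃ i m, IsLeadMonV μ.lt (F i) m ∧ v = leadTermV (F i) m}

/-- The colon ideal `Mᵢ = ⟨L(F₁),...,L(F_{i-1})⟩ : L(Fᵢ)` for vectors, where `LM j` is
the leading monomial of `F j`. -/
noncomputable def colonV {r₀ r₁ : ℕ} (F : Fin r₁ → (Fin r₀ → MvPolynomial (Fin n) k))
    (LM : Fin r₁ → (Fin n →₀ ℕ) × Fin r₀) (i : Fin r₁) : Ideal (MvPolynomial (Fin n) k) :=
  Submodule.colon
    (Submodule.span (MvPolynomial (Fin n) k)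
      {v | ∃ j, j < i ∧ v = leadTermV (F j) (LM j)})
    (Submodule.span (MvPolynomial (Fin n) k) {leadTermV (F i) (LM i)})

/-- The induced monomial order `>₁` on `R^{r₁}` determined by `F₁,...,F_{r₁} ∈ R^{r₀}`
with leading monomials `LM`: `x^α eᵢ >₁ x^β e_j` iff `x^α L(Fᵢ) > x^β L(F_j)`, or
`x^α L(Fᵢ) = x^β L(F_j)` up to a scalar and `i > j`. -/
def inducedLt {r₀ r₁ : ℕ} (μ : VecMonomialOrd n r₀)
    (LM : Fin r₁ → (Fin n →₀ ℕ) × Fin r₀)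
    (a b : (Fin n →₀ ℕ) × Fin r₁) : Prop :=
  μ.lt (a.1 + (LM a.2).1, (LM a.2).2) (b.1 + (LM b.2).1, (LM b.2).2) ∨
    ((a.1 + (LM a.2).1 = b.1 + (LM b.2).1 ∧ (LM a.2).2 = (LM b.2).2) ∧ b.2 < a.2)

/-- The induced monomial order `>₁` on `R^r` determined by nonzero `f₁,...,f_r ∈ R`:
`x^α eᵢ >₁ x^β e_j` iff `x^α L(fᵢ) > x^β L(f_j)`, or `x^α L(fᵢ) = x^β L(f_j)` up to a
scalar and `i > j`. -/
def inducedLtS (μ : MonomialOrd n) {r : ℕ} (f : Fin r → MvPolynomial (Fin n) k)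
    (a b : (Fin n →₀ ℕ) × Fin r) : Prop :=
  μ.lt (a.1 + leadMon μ (f a.2)) (b.1 + leadMon μ (f b.2)) ∨
    (a.1 + leadMon μ (f a.2) = b.1 + leadMon μ (f b.2) ∧ b.2 < a.2)


section Aux

theorem MonomialOrd.add_left' (μ : MonomialOrd n) {a b : Fin n →₀ ℕ} (c : Fin n →₀ ℕ)
    (h : μ.lt a b) : μ.lt (c + a) (c + b) := by
  rw [add_comm c a, add_comm c b]; exact μ.add_right _ _ _ h

theorem MonomialOrd.zero_or (μ : MonomialOrd n) (c : Fin n →₀ ℕ) : c = 0 ∨ μ.lt 0 c := by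
  classical
  induction c using Finsupp.induction_linear with
  | zero => exact Or.inl rfl
  | add a b ha hb =>
    rcases ha with rfl | ha
    · simpa using hb
    · rcases hb with rfl | hb
      · right; simpa using ha
      · right
        have h1 := μ.add_right _ _ b ha
        rw [zero_add] at h1
        exact μ.lt_trans _ _ _ hb h1
  | single i m =>
    induction m with
    | zero => left; simp
    | succ m ih =>
      right
      have h1 := μ.add_right _ _ (Finsupp.single i m) (μ.var_pos i)
      rw [zero_add, ← Finsupp.single_add, add_comm 1 m] at h1
      rcases ih with h0 | h0
      · rwa [h0] at h1
      · exact μ.lt_trans _ _ _ h0 h1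

theorem MonomialOrd.of_le (μ : MonomialOrd n) {a b : Fin n →₀ ℕ} (h : a ≤ b) :
    a = b ∨ μ.lt a b := by
  obtain ⟨c, rfl⟩ := le_iff_exists_add.mp h
  rcases μ.zero_or c with rfl | hc
  · left; simp
  · right; simpa using μ.add_left' a hc

theorem MonomialOrd.wf (μ : MonomialOrd n) : WellFounded μ.lt := by
  have : IsStrictOrder _ μ.lt :=
    { irrefl := μ.lt_irrefl, trans := μ.lt_trans }
  rw [RelEmbedding.wellFounded_iff_isEmpty]
  refine ⟨fun e => ?_⟩
  obtain ⟨a, b, hab, hle⟩ := wellQuasiOrdered_le (α := Fin n →₀ ℕ) e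
  have h1 : μ.lt (e b) (e a) := e.map_rel_iff.2 hab
  rcases μ.of_le hle with h | h
  · rw [h] at h1; exact μ.lt_irrefl _ h1
  · exact μ.lt_irrefl _ (μ.lt_trans _ _ _ h h1)

theorem MonomialOrd.exists_max (μ : MonomialOrd n) {ι : Type*} (w : ι → (Fin n →₀ ℕ))
    (s : Finset ι) (hs : s.Nonempty) : ∃ x ∈ s, ∀ y ∈ s, w y = w x ∨ μ.lt (w y) (w x) := by
  classical
  induction hs using Finset.Nonempty.cons_induction with
  | singleton a => exact ⟨a, by simp, by simp⟩
  | cons a s ha hs ih =>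
    obtain ⟨x, hx, hmax⟩ := ih
    rcases μ.trichotomy (w a) (w x) with h | h | h
    · refine ⟨x, by simp [hx], fun y hy => ?_⟩
      rcases Finset.mem_cons.1 hy with rfl | hy
      · exact Or.inr h
      · exact hmax y hy
    · refine ⟨x, by simp [hx], fun y hy => ?_⟩
      rcases Finset.mem_cons.1 hy with rfl | hy
      · exact Or.inl h
      · exact hmax y hy
    · refine ⟨a, by simp, fun y hy => ?_⟩
      rcases Finset.mem_cons.1 hy with rfl | hy
      · exact Or.inl rfl
      · rcases hmax y hy with h2 | h2
        · rw [h2]; exact Or.inr h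
        · exact Or.inr (μ.lt_trans _ _ _ h2 h)

theorem monDvd_iff {a b : Fin n →₀ ℕ} : MonDvd a b ↔ a ≤ b := le_iff_exists_add.symm

theorem IsLeadMon.unique {μ : MonomialOrd n} {g : MvPolynomial (Fin n) k} {a b : Fin n →₀ ℕ}
    (ha : IsLeadMon μ g a) (hb : IsLeadMon μ g b) : a = b := by
  by_contra h
  exact μ.lt_irrefl _ (μ.lt_trans _ _ _ (hb.2 a ha.1 h) (ha.2 b hb.1 (Ne.symm h)))

theorem isLeadMon_leadMon (μ : MonomialOrd n) {g : MvPolynomial (Fin n) k} (hg : g ≠ 0) :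
    IsLeadMon μ g (leadMon μ g) := by
  have h : ∃ β, IsLeadMon μ g β := by
    obtain ⟨x, hx, hm⟩ := μ.exists_max id g.support (by
      rw [Finset.nonempty_iff_ne_empty]; simpa [support_eq_empty] using hg)
    exact ⟨x, hx, fun γ hγ hne => (hm γ hγ).resolve_left hne⟩
  unfold leadMon
  rw [dif_pos h]
  exact h.choose_spec

theorem coeff_leadMon_ne (μ : MonomialOrd n) {g : MvPolynomial (Fin n) k} (hg : g ≠ 0) :
    coeff (leadMon μ g) g ≠ 0 := mem_support_iff.1 (isLeadMon_leadMon μ hg).1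

theorem leadMon_max (μ : MonomialOrd n) {g : MvPolynomial (Fin n) k} {γ : Fin n →₀ ℕ}
    (h : γ ∈ g.support) : γ = leadMon μ g ∨ μ.lt γ (leadMon μ g) := by
  have hg : g ≠ 0 := by rintro rfl; simp at h
  by_cases h1 : γ = leadMon μ g
  · exact Or.inl h1
  · exact Or.inr ((isLeadMon_leadMon μ hg).2 γ h h1)

theorem leadTerm_zero' (μ : MonomialOrd n) : leadTerm μ (0 : MvPolynomial (Fin n) k) = 0 := by
  simp [leadTerm]

theorem isLeadMon_monomial_mul (μ : MonomialOrd n) {g : MvPolynomial (Fin n) k} (hg : g ≠ 0)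
    (α : Fin n →₀ ℕ) : IsLeadMon μ (monomial α (1 : k) * g) (α + leadMon μ g) := by
  refine ⟨?_, fun γ hγ hne => ?_⟩
  · rw [mem_support_iff, coeff_monomial_mul, one_mul]
    exact coeff_leadMon_ne μ hg
  · rw [mem_support_iff, coeff_monomial_mul'] at hγ
    split_ifs at hγ with hle
    · obtain ⟨c, rfl⟩ := le_iff_exists_add.mp hle
      rw [add_tsub_cancel_left, one_mul, ← mem_support_iff] at hγ
      rcases leadMon_max μ hγ with h | h
      · exact absurd (by rw [h]) hne
      · exact μ.add_left' α h
    · exact absurd rfl hγ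

/-- Membership in an ideal spanned by leading terms. -/
theorem mem_span_leadTerm (μ : MonomialOrd n) {r : ℕ} (f : Fin r → MvPolynomial (Fin n) k)
    (hf : ∀ i, f i ≠ 0) (J : Set (Fin r)) (p : MvPolynomial (Fin n) k) :
    p ∈ Ideal.span ((fun j => leadTerm μ (f j)) '' J) ↔
      ∀ γ ∈ p.support, ∃ j ∈ J, leadMon μ (f j) ≤ γ := by
  have key : Ideal.span ((fun j => leadTerm μ (f j)) '' J) =
      Ideal.span ((fun s => monomial s (1 : k)) '' ((fun j => leadMon μ (f j)) '' J)) := by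
    apply le_antisymm
    · rw [Ideal.span_le]
      rintro _ ⟨j, hj, rfl⟩
      have : leadTerm μ (f j) = C (coeff (leadMon μ (f j)) (f j)) *
          monomial (leadMon μ (f j)) (1 : k) := by
        rw [C_mul_monomial, mul_one]; rfl
      simp only [SetLike.mem_coe]
      rw [this]
      exact Ideal.mul_mem_left _ _ (Ideal.subset_span ⟨_, ⟨j, hj, rfl⟩, rfl⟩)
    · rw [Ideal.span_le]
      rintro _ ⟨_, ⟨j, hj, rfl⟩, rfl⟩
      have : monomial (leadMon μ (f j)) (1 : k) =
          C (coeff (leadMon μ (f j)) (f j))⁻¹ * leadTerm μ (f j) := by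
        rw [leadTerm, C_mul_monomial, inv_mul_cancel₀ (coeff_leadMon_ne μ (hf j))]
      simp only [SetLike.mem_coe]
      rw [this]
      exact Ideal.mul_mem_left _ _ (Ideal.subset_span ⟨j, hj, rfl⟩)
  rw [key, mem_ideal_span_monomial_image]
  simp

theorem monomial_mem_colon (μ : MonomialOrd n) {r : ℕ} (f : Fin r → MvPolynomial (Fin n) k)
    (hf : ∀ i, f i ≠ 0) (i : Fin r) (α : Fin n →₀ ℕ) :
    monomial α (1 : k) ∈ colonIdeal μ f i ↔
      ∃ j, j < i ∧ leadMon μ (f j) ≤ α + leadMon μ (f i) := by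
  classical
  have hset : {p | ∃ j, j < i ∧ p = leadTerm μ (f j)} =
      (fun j => leadTerm μ (f j)) '' {j | j < i} := by
    ext p
    constructor
    · rintro ⟨j, hj, rfl⟩; exact ⟨j, hj, rfl⟩
    · rintro ⟨j, hj, rfl⟩; exact ⟨j, hj, rfl⟩
  have h1 : monomial α (1 : k) ∈ colonIdeal μ f i ↔
      monomial α (1 : k) * leadTerm μ (f i) ∈
        Ideal.span ((fun j => leadTerm μ (f j)) '' {j | j < i}) := by
    unfold colonIdeal
    rw [Submodule.mem_colon, hset]
    constructor
    · intro h
      exact h _ (Ideal.subset_span rfl)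
    · intro h s hs
      obtain ⟨c, rfl⟩ := Ideal.mem_span_singleton'.1 hs
      rw [smul_eq_mul, mul_left_comm]
      exact Ideal.mul_mem_left _ _ h
  rw [h1, mem_span_leadTerm μ f hf, leadTerm, monomial_mul, one_mul,
    support_monomial, if_neg (coeff_leadMon_ne μ (hf i))]
  simp

/-- Admissible quotients. -/
def AdmQ (μ : MonomialOrd n) {r : ℕ} (f : Fin r → MvPolynomial (Fin n) k)
    (q : Fin r → MvPolynomial (Fin n) k) : Prop :=
  ∀ i : Fin r, ∀ γ ∈ (q i).support, ∀ j, j < i →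
      ¬ MonDvd (leadMon μ (f j)) (γ + leadMon μ (f i))

/-- Polynomials having a division expression with remainder supported in `S`. -/
def divSub (μ : MonomialOrd n) {r : ℕ} (f : Fin r → MvPolynomial (Fin n) k)
    (S : Set (Fin n →₀ ℕ)) : Submodule k (MvPolynomial (Fin n) k) where
  carrier := {g | ∃ q h, AdmQ μ f q ∧ (∀ γ ∈ support h, γ ∈ S) ∧ g = (∑ i, q i * f i) + h}
  zero_mem' := ⟨0, 0, by intro i γ h; simp at h, by simp, by simp⟩
  add_mem' := by
    classical
    rintro _ _ ⟨q, h, hq, hh, rfl⟩ ⟨q', h', hq', hh', rfl⟩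
    refine ⟨q + q', h + h', fun i γ hγ => ?_, fun γ hγ => ?_, ?_⟩
    · rcases Finset.mem_union.1 (support_add hγ) with h1 | h1
      · exact hq i γ h1
      · exact hq' i γ h1
    · rcases Finset.mem_union.1 (support_add hγ) with h1 | h1
      · exact hh γ h1
      · exact hh' γ h1
    · simp only [Pi.add_apply, add_mul, Finset.sum_add_distrib]; abel
  smul_mem' := by
    rintro c _ ⟨q, h, hq, hh, rfl⟩
    refine ⟨c • q, c • h, fun i γ hγ => hq i γ (support_smul hγ),
      fun γ hγ => hh γ (support_smul hγ), ?_⟩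
    simp [smul_add, Finset.smul_sum]

theorem adm_mem_divSub (μ : MonomialOrd n) {r : ℕ} (f : Fin r → MvPolynomial (Fin n) k)
    (S : Set (Fin n →₀ ℕ)) (i : Fin r) (γ : Fin n →₀ ℕ)
    (h : ∀ j, j < i → ¬ leadMon μ (f j) ≤ γ + leadMon μ (f i)) :
    monomial γ (1 : k) * f i ∈ divSub μ f S := by
  classical
  refine ⟨Pi.single i (monomial γ 1), 0, fun j ε hε l hl => ?_, by simp, ?_⟩
  · by_cases hji : j = i
    · subst hji
      rw [Pi.single_eq_same, support_monomial, if_neg one_ne_zero, Finset.mem_singleton] at hε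
      subst hε
      rw [monDvd_iff]
      exact h l hl
    · rw [Pi.single_eq_of_ne hji] at hε
      simp at hε
  · rw [add_zero, Finset.sum_eq_single i]
    · rw [Pi.single_eq_same]
    · intro j _ hj; rw [Pi.single_eq_of_ne hj, zero_mul]
    · simp

theorem mem_of_monomials (W : Submodule k (MvPolynomial (Fin n) k))
    (p g : MvPolynomial (Fin n) k) (h : ∀ ε ∈ p.support, monomial ε (1 : k) * g ∈ W) :
    p * g ∈ W := by
  rw [p.as_sum, Finset.sum_mul]
  refine W.sum_mem fun ε hε => ?_
  have : monomial ε (coeff ε p) * g = coeff ε p • (monomial ε (1 : k) * g) := by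
    rw [← smul_mul_assoc, smul_monomial, smul_eq_mul, mul_one]
  rw [this]
  exact W.smul_mem _ (h ε hε)

/-- Division with remainder. -/
theorem division_exists (μ : MonomialOrd n) {r : ℕ} (f : Fin r → MvPolynomial (Fin n) k)
    (hf : ∀ i, f i ≠ 0) (g : MvPolynomial (Fin n) k) :
    g ∈ divSub μ f {γ | ∀ i, ¬ MonDvd (leadMon μ (f i)) γ} := by
  classical
  set W := divSub μ f {γ | ∀ i, ¬ MonDvd (leadMon μ (f i)) γ} with hW
  have mon : ∀ β, monomial β (1 : k) ∈ W := by
    intro β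
    induction β using μ.wf.induction with
    | _ β ih =>
    by_cases hex : ∃ j, leadMon μ (f j) ≤ β
    · obtain ⟨j, hj, hmin⟩ := WellFounded.has_min (wellFounded_lt (α := Fin r))
        {j | leadMon μ (f j) ≤ β} hex
      rw [Set.mem_ofPred_eq] at hj
      obtain ⟨γ, rfl⟩ := le_iff_exists_add'.mp hj
      have h1 : monomial γ (1 : k) * f j ∈ W :=
        adm_mem_divSub μ f _ j γ fun l hl hle => hmin l hle hl
      set c := coeff (leadMon μ (f j)) (f j) with hc
      have hc0 : c ≠ 0 := coeff_leadMon_ne μ (hf j)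
      have hL := isLeadMon_monomial_mul μ (hf j) γ
      have h2 : monomial γ (1 : k) * f j - c • monomial (γ + leadMon μ (f j)) (1 : k) ∈ W := by
        rw [← mul_one (monomial γ (1 : k) * f j - _)]
        apply mem_of_monomials
        intro ε hε
        rw [mul_one]
        have hne : ε ≠ γ + leadMon μ (f j) := by
          rintro rfl
          rw [mem_support_iff, coeff_sub, coeff_monomial_mul, coeff_smul, coeff_monomial] at hε
          simp [hc] at hε
        apply ih
        refine hL.2 ε ?_ hne
        rw [mem_support_iff, coeff_sub, coeff_smul, coeff_monomial, if_neg (Ne.symm hne)] at hε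
        rw [mem_support_iff]
        simpa using hε
      have h3 := W.smul_mem c⁻¹ (W.sub_mem h1 h2)
      rwa [sub_sub_cancel, smul_smul, inv_mul_cancel₀ hc0, one_smul] at h3
    · refine ⟨0, monomial β 1, by intro i γ h; simp at h, ?_, by simp⟩
      intro γ hγ
      rw [support_monomial, if_neg one_ne_zero, Finset.mem_singleton] at hγ
      subst hγ
      intro i hi
      exact hex ⟨i, monDvd_iff.1 hi⟩
  rw [← mul_one g]
  exact mem_of_monomials W g 1 fun ε _ => by rw [mul_one]; exact mon ε

theorem adm_leadMon (μ : MonomialOrd n) {r : ℕ} (f : Fin r → MvPolynomial (Fin n) k)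
    (hf : ∀ i, f i ≠ 0) (q : Fin r → MvPolynomial (Fin n) k) (hq : AdmQ μ f q)
    (i₀ : Fin r) (γ₀ : Fin n →₀ ℕ) (h₀ : γ₀ ∈ (q i₀).support) :
    ∃ i γ, γ ∈ (q i).support ∧ IsLeadMon μ (∑ j, q j * f j) (γ + leadMon μ (f i)) ∧
      ∀ j ε, ε ∈ (q j).support → ε + leadMon μ (f j) = γ + leadMon μ (f i) ∨
        μ.lt (ε + leadMon μ (f j)) (γ + leadMon μ (f i)) := by
  classical
  obtain ⟨⟨i, γ⟩, hx, hmax⟩ := μ.exists_max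
    (fun p : (Σ _ : Fin r, (Fin n →₀ ℕ)) => p.2 + leadMon μ (f p.1))
    (Finset.univ.sigma fun j => (q j).support) ⟨⟨i₀, γ₀⟩, by simpa using h₀⟩
  have hγ : γ ∈ (q i).support := by simpa using hx
  have hm : ∀ j ε, ε ∈ (q j).support → ε + leadMon μ (f j) = γ + leadMon μ (f i) ∨
        μ.lt (ε + leadMon μ (f j)) (γ + leadMon μ (f i)) := fun j ε hε =>
    hmax ⟨j, ε⟩ (by simpa using hε)
  -- terms of the products
  have hle : ∀ j ε η, ε ∈ (q j).support → η ∈ (f j).support →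
      (μ.lt (ε + η) (γ + leadMon μ (f i))) ∨
        (η = leadMon μ (f j) ∧ ε + leadMon μ (f j) = γ + leadMon μ (f i)) := by
    intro j ε η hε hη
    rcases leadMon_max μ hη with h1 | h1
    · rw [← h1]
      rcases hm j ε hε with h2 | h2
      · right; exact ⟨rfl, by rw [h1]; exact h2⟩
      · left; rw [h1]; exact h2
    · left
      have h3 := μ.add_left' ε h1
      rcases hm j ε hε with h2 | h2
      · rwa [h2] at h3
      · exact μ.lt_trans _ _ _ h3 h2
  have hij : ∀ j ε, ε ∈ (q j).support → ε + leadMon μ (f j) = γ + leadMon μ (f i) →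
      j = i ∧ ε = γ := by
    intro j ε hε heq
    rcases lt_trichotomy j i with h | h | h
    · exact absurd (monDvd_iff.2 (by rw [← heq]; exact le_add_self)) (hq i γ hγ j h)
    · subst h; exact ⟨rfl, add_right_cancel heq⟩
    · exact absurd (monDvd_iff.2 (by rw [heq]; exact le_add_self)) (hq j ε hε i h)
  refine ⟨i, γ, hγ, ⟨?_, ?_⟩, hm⟩
  · rw [mem_support_iff, coeff_sum, Finset.sum_eq_single i]
    · rw [coeff_mul, Finset.sum_eq_single (γ, leadMon μ (f i))]
      · exact mul_ne_zero (mem_support_iff.1 hγ) (coeff_leadMon_ne μ (hf i))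
      · rintro ⟨ε, η⟩ hp hne
        rw [Finset.HasAntidiagonal.mem_antidiagonal] at hp
        simp only at hp ⊢
        by_contra hnz
        obtain ⟨ha, hb⟩ := mul_ne_zero_iff.1 hnz
        rcases hle i ε η (mem_support_iff.2 ha) (mem_support_iff.2 hb) with h | ⟨rfl, h⟩
        · rw [hp] at h; exact μ.lt_irrefl _ h
        · exact hne (by rw [(add_right_cancel h : ε = γ)])
      · intro h
        exfalso
        apply h
        rw [Finset.HasAntidiagonal.mem_antidiagonal]
    · intro j _ hj
      by_contra hnz
      have hs := support_mul (q j) (f j) (mem_support_iff.2 hnz)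
      obtain ⟨ε, hε, η, hη, hsum⟩ := Finset.mem_add.1 hs
      rcases hle j ε η hε hη with h | ⟨_, h⟩
      · rw [hsum] at h; exact μ.lt_irrefl _ h
      · exact hj (hij j ε hε h).1
    · simp
  · intro ζ hζ hne
    rw [mem_support_iff, coeff_sum] at hζ
    obtain ⟨j, _, hj⟩ := Finset.exists_ne_zero_of_sum_ne_zero hζ
    have hs := support_mul (q j) (f j) (mem_support_iff.2 hj)
    obtain ⟨ε, hε, η, hη, hsum⟩ := Finset.mem_add.1 hs
    rw [← hsum] at hne ⊢
    rcases hle j ε η hε hη with h | ⟨h, h'⟩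
    · exact h
    · exact absurd (by rw [h, h']) hne

theorem exists_minGen (I : Ideal (MvPolynomial (Fin n) k)) (γ : Fin n →₀ ℕ)
    (h : monomial γ (1 : k) ∈ I) : ∃ α, α ≤ γ ∧ IsMinGen I α := by
  induction γ using WellFoundedLT.induction with
  | _ γ ih =>
  by_cases hm : IsMinGen I γ
  · exact ⟨γ, le_rfl, hm⟩
  · have : ∃ β, MonDvd β γ ∧ β ≠ γ ∧ monomial β (1 : k) ∈ I := by
      by_contra hc
      push Not at hc
      exact hm ⟨h, hc⟩
    obtain ⟨β, hβ, hne, hmem⟩ := this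
    have hle := monDvd_iff.1 hβ
    obtain ⟨α, h1, h2⟩ := ih β (lt_of_le_of_ne hle hne) hmem
    exact ⟨α, h1.trans hle, h2⟩

theorem isRemainder_zero_iff (μ : MonomialOrd n) {r : ℕ} (f : Fin r → MvPolynomial (Fin n) k)
    (g : MvPolynomial (Fin n) k) :
    IsRemainder μ f g 0 ↔ ∃ q, AdmQ μ f q ∧ g = ∑ i, q i * f i := by
  constructor
  · rintro ⟨q, h1, h2, -⟩
    exact ⟨q, h2, by simpa using h1⟩
  · rintro ⟨q, h1, h2⟩
    exact ⟨q, by simpa using h2, h1, by simp⟩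

theorem mem_divSub_empty (μ : MonomialOrd n) {r : ℕ} (f : Fin r → MvPolynomial (Fin n) k)
    (g : MvPolynomial (Fin n) k) :
    g ∈ divSub μ f ∅ ↔ ∃ q, AdmQ μ f q ∧ g = ∑ i, q i * f i := by
  constructor
  · rintro ⟨q, h, h1, h2, h3⟩
    have : h = 0 := by
      rw [← support_eq_empty, Finset.eq_empty_iff_forall_notMem]
      exact fun γ hγ => h2 γ hγ
    exact ⟨q, h1, by simpa [this] using h3⟩
  · rintro ⟨q, h1, h2⟩
    exact ⟨q, 0, h1, by simp, by simpa using h2⟩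

theorem buchberger_reduction (μ : MonomialOrd n) {r : ℕ}
    (f : Fin r → MvPolynomial (Fin n) k) (hf : ∀ i, f i ≠ 0)
    (H : ∀ (i : Fin r) (α : Fin n →₀ ℕ), IsMinGen (colonIdeal μ f i) α →
        IsRemainder μ f (MvPolynomial.monomial α (1 : k) * f i) 0) :
    ∀ (β : Fin n →₀ ℕ) (i : Fin r) (γ : Fin n →₀ ℕ), γ + leadMon μ (f i) = β →
      monomial γ (1 : k) * f i ∈ divSub μ f ∅ := by
  classical
  intro β
  induction β using μ.wf.induction with
  | _ β ihβ =>
  intro i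
  induction i using WellFoundedLT.induction with
  | _ i ihi =>
  intro γ hγ
  by_cases hadm : ∃ j, j < i ∧ leadMon μ (f j) ≤ γ + leadMon μ (f i)
  · obtain ⟨α, hle, hmin⟩ := exists_minGen _ γ ((monomial_mem_colon μ f hf i γ).2 hadm)
    obtain ⟨δ, rfl⟩ := le_iff_exists_add'.mp hle
    obtain ⟨q, hq, hsum⟩ := (isRemainder_zero_iff μ f _).1 (H i α hmin)
    obtain ⟨l, hl, hlα⟩ := (monomial_mem_colon μ f hf i α).1 hmin.1
    have hmon : monomial (δ + α) (1 : k) = monomial δ 1 * monomial α 1 := by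
      rw [monomial_mul, one_mul]
    rw [hmon, mul_assoc, hsum, Finset.mul_sum]
    refine Submodule.sum_mem _ fun j _ => ?_
    rw [← mul_assoc]
    apply mem_of_monomials
    intro ε' hε'
    have hs := support_mul _ _ hε'
    obtain ⟨δ', hδ', ε, hε, rfl⟩ := Finset.mem_add.1 hs
    rw [support_monomial, if_neg one_ne_zero, Finset.mem_singleton] at hδ'
    subst hδ'
    obtain ⟨i', γ', hγ', hlead, hmax⟩ := adm_leadMon μ f hf q hq j ε hε
    rw [← hsum] at hlead
    have heq := hlead.unique (isLeadMon_monomial_mul μ (hf i) α)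
    have hb := hmax j ε hε
    rw [heq] at hb
    rcases hb with hb | hb
    · have hji : j < i := by
        rcases lt_trichotomy j i with h | h | h
        · exact h
        · subst h
          exact absurd (monDvd_iff.2 (by rw [hb]; exact hlα)) (hq j ε hε l hl)
        · exact absurd (monDvd_iff.2 (by rw [hb]; exact le_add_self)) (hq j ε hε i h)
      apply ihi j hji
      rw [add_assoc, hb, ← add_assoc, hγ]
    · refine ihβ _ ?_ j (δ' + ε) rfl
      rw [← hγ, add_assoc, add_assoc]
      exact μ.add_left' _ hb
  · push Not at hadm
    exact adm_mem_divSub μ f _ i γ hadm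

end Aux

/-- **Buchberger's Criterion.** Nonzero `f₁,...,f_r` form a Gröbner basis if and only if
for each `i` and each minimal monomial generator `x^α` of
`Mᵢ = ⟨L(f₁),...,L(f_{i-1})⟩ : L(fᵢ)`, the remainder of `x^α fᵢ` upon division by
`f₁,...,f_r` (in this order) is zero. -/
theorem buchberger_criterion (μ : MonomialOrd n) {r : ℕ}
    (f : Fin r → MvPolynomial (Fin n) k) (hf : ∀ i, f i ≠ 0) :
    IsGroebner μ f ↔
      ∀ (i : Fin r) (α : Fin n →₀ ℕ), IsMinGen (colonIdeal μ f i) α →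
        IsRemainder μ f (MvPolynomial.monomial α (1 : k) * f i) 0 := by
  have hspan : ∀ p, p ∈ Ideal.span (Set.range fun i => leadTerm μ (f i)) ↔
      ∀ γ ∈ p.support, ∃ j, leadMon μ (f j) ≤ γ := by
    intro p
    have := mem_span_leadTerm μ f hf Set.univ p
    rw [Set.image_univ] at this
    simpa using this
  constructor
  · intro hG i α _
    obtain ⟨q, h, hq, hh, hsum⟩ := division_exists μ f hf (monomial α (1 : k) * f i)
    have hmem : h ∈ Ideal.span (Set.range f) := by
      have : h = monomial α (1 : k) * f i - ∑ i, q i * f i := by rw [hsum]; ring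
      rw [this]
      refine Ideal.sub_mem _ (Ideal.mul_mem_left _ _ (Ideal.subset_span ⟨i, rfl⟩))
        (Ideal.sum_mem _ fun j _ => Ideal.mul_mem_left _ _ (Ideal.subset_span ⟨j, rfl⟩))
    have h0 : h = 0 := by
      by_contra hne
      have h1 : leadTerm μ h ∈ Ideal.span (Set.range fun i => leadTerm μ (f i)) := by
        rw [← hG]
        exact Ideal.subset_span ⟨h, hmem, rfl⟩
      have hL := isLeadMon_leadMon μ hne
      obtain ⟨j, hj⟩ := (hspan _).1 h1 (leadMon μ h) (by
        rw [mem_support_iff, leadTerm, coeff_monomial, if_pos rfl]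
        exact coeff_leadMon_ne μ hne)
      exact hh _ hL.1 j (monDvd_iff.2 hj)
    rw [isRemainder_zero_iff]
    exact ⟨q, hq, by rw [hsum, h0, add_zero]⟩
  · intro H
    have red := buchberger_reduction μ f hf H
    unfold IsGroebner
    apply le_antisymm
    · rw [Ideal.span_le]
      rintro _ ⟨g, hg, rfl⟩
      have hgW : g ∈ divSub μ f ∅ := by
        obtain ⟨c, rfl⟩ := (Submodule.mem_span_range_iff_exists_fun _).1 hg
        refine Submodule.sum_mem _ fun i _ => ?_
        rw [smul_eq_mul]
        exact mem_of_monomials _ _ _ fun ε _ => red _ i ε rfl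
      obtain ⟨q, hq, hsum⟩ := (mem_divSub_empty μ f g).1 hgW
      by_cases hg0 : g = 0
      · rw [hg0, leadTerm_zero']; exact Ideal.zero_mem _
      · have : ∃ i₀ γ₀, γ₀ ∈ (q i₀).support := by
          by_contra hc
          push Not at hc
          apply hg0
          rw [hsum]
          refine Finset.sum_eq_zero fun i _ => ?_
          have : q i = 0 := by
            rw [← support_eq_empty, Finset.eq_empty_iff_forall_notMem]
            exact hc i
          rw [this, zero_mul]
        obtain ⟨i₀, γ₀, h₀⟩ := this
        obtain ⟨i, γ, _, hlead, _⟩ := adm_leadMon μ f hf q hq i₀ γ₀ h₀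
        rw [← hsum] at hlead
        have heq := (isLeadMon_leadMon μ hg0).unique hlead
        rw [SetLike.mem_coe, hspan]
        intro ζ hζ
        have hz := support_monomial_subset hζ
        rw [Finset.mem_singleton] at hz
        exact ⟨i, by rw [hz, heq]; exact le_add_self⟩
    · rw [Ideal.span_le]
      rintro _ ⟨i, rfl⟩
      exact Ideal.subset_span ⟨f i, Ideal.subset_span ⟨i, rfl⟩, rfl⟩
end

section
/- (Macaulay.) Let > be a global monomial order on R = k[x₁,...,xₙ] and let f₁,...,f_r ∈ R be nonzero polynomials forming a Gröbner basis. Then the residue classes of the monomials x^α that do not lie in the monomial ideal ⟨L(f₁),...,L(f_r)⟩ form a k-vector space basis of the quotient ring R/⟨f₁,...,f_r⟩. -/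
open MvPolynomial

variable {k : Type*} [Field k] {n : ℕ}

theorem exists_isLeadMon (μ : MonomialOrd n) (f : MvPolynomial (Fin n) k) (hf : f ≠ 0) :
    ∃ β, IsLeadMon μ f β := by
  have key : ∀ s : Finset (Fin n →₀ ℕ), s.Nonempty → ∃ β ∈ s, ∀ γ ∈ s, γ ≠ β → μ.lt γ β := by
    intro s hs
    induction hs using Finset.Nonempty.cons_induction with
    | singleton a => exact ⟨a, by simp, by simp⟩
    | cons a s ha hs ih =>
      obtain ⟨β, hβ, hm⟩ := ih
      rcases μ.trichotomy a β with h | h | h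
      · refine ⟨β, by simp [hβ], ?_⟩
        intro γ hγ hne
        rcases Finset.mem_cons.1 hγ with rfl | hγ
        · exact h
        · exact hm γ hγ hne
      · exact absurd (h ▸ hβ) ha
      · refine ⟨a, by simp, ?_⟩
        intro γ hγ hne
        rcases Finset.mem_cons.1 hγ with rfl | hγ
        · exact absurd rfl hne
        · by_cases h1 : γ = β
          · rw [h1]; exact h
          · exact μ.lt_trans _ _ _ (hm γ hγ h1) h
  exact key f.support (MvPolynomial.support_nonempty.2 hf)

theorem leadMon_spec (μ : MonomialOrd n) (f : MvPolynomial (Fin n) k) (hf : f ≠ 0) :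
    IsLeadMon μ f (leadMon μ f) := by
  have h := exists_isLeadMon μ f hf
  unfold leadMon
  rw [dif_pos h]
  exact h.choose_spec

theorem MonomialOrd.zero_le (μ : MonomialOrd n) (a : Fin n →₀ ℕ) : a = 0 ∨ μ.lt 0 a := by
  induction a using Finsupp.induction_linear with
  | zero => exact Or.inl rfl
  | add a b ha hb =>
    rcases ha with rfl | ha
    · simpa using hb
    · rcases hb with rfl | hb
      · simpa using Or.inr ha
      · right
        have := μ.add_right _ _ b ha
        rw [zero_add] at this
        exact μ.lt_trans _ _ _ hb this
  | single i m =>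
    induction m with
    | zero => simp
    | succ m ih =>
      right
      have h := μ.add_right _ _ (Finsupp.single i m) (μ.var_pos i)
      rw [zero_add, ← Finsupp.single_add, add_comm 1 m] at h
      rcases ih with h0 | h0
      · rwa [h0] at h
      · exact μ.lt_trans _ _ _ h0 h

theorem exists_le_of_mem (μ : MonomialOrd n) {r : ℕ}
    (f : Fin r → MvPolynomial (Fin n) k) (α : Fin n →₀ ℕ)
    (h : monomial α (1 : k) ∈ Ideal.span (Set.range fun i => leadTerm μ (f i))) :
    ∃ i, leadMon μ (f i) ≤ α := by
  have hle : Ideal.span (Set.range fun i => leadTerm μ (f i)) ≤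
      Ideal.span ((fun s => monomial s (1 : k)) '' Set.range fun i => leadMon μ (f i)) := by
    rw [Ideal.span_le]
    rintro _ ⟨i, rfl⟩
    have : leadTerm μ (f i) = C (coeff (leadMon μ (f i)) (f i)) *
        monomial (leadMon μ (f i)) (1 : k) := by
      simp [leadTerm, C_mul_monomial]
    simp only [this]
    exact Ideal.mul_mem_left _ _ (Ideal.subset_span ⟨_, ⟨i, rfl⟩, rfl⟩)
  have h2 := mem_ideal_span_monomial_image.1 (hle h) α (by simp)
  obtain ⟨_, ⟨i, rfl⟩, hi⟩ := h2
  exact ⟨i, hi⟩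

/-- **Macaulay's theorem.** If `f₁,...,f_r` is a Gröbner basis, the residue classes of
the monomials `x^α ∉ ⟨L(f₁),...,L(f_r)⟩` form a `k`-vector space basis of
`R/⟨f₁,...,f_r⟩`. -/
theorem macaulay_basis (μ : MonomialOrd n) {r : ℕ}
    (f : Fin r → MvPolynomial (Fin n) k) (hf : ∀ i, f i ≠ 0) (hGB : IsGroebner μ f) :
    LinearIndependent k
      (fun α : {α : Fin n →₀ ℕ // MvPolynomial.monomial α (1 : k) ∉
          Ideal.span (Set.range fun i => leadTerm μ (f i))} =>
        Ideal.Quotient.mk (Ideal.span (Set.range f))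
          (MvPolynomial.monomial α.1 (1 : k))) ∧
    Submodule.span k
      (Set.range (fun α : {α : Fin n →₀ ℕ // MvPolynomial.monomial α (1 : k) ∉
          Ideal.span (Set.range fun i => leadTerm μ (f i))} =>
        Ideal.Quotient.mk (Ideal.span (Set.range f))
          (MvPolynomial.monomial α.1 (1 : k)))) = ⊤ := by
  classical
  constructor
  · rw [linearIndependent_iff]
    intro l hl
    by_contra hne
    set p : MvPolynomial (Fin n) k := l.sum fun α c => monomial α.1 c with hp
    have hcoeff : ∀ β, coeff β p ≠ 0 → ∃ α ∈ l.support, α.1 = β := by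
      intro β hβ
      rw [hp, Finsupp.sum, coeff_sum] at hβ
      obtain ⟨α, hα, h⟩ := Finset.exists_ne_zero_of_sum_ne_zero hβ
      refine ⟨α, hα, ?_⟩
      by_contra h'
      exact h (by rw [coeff_monomial, if_neg h'])
    have hp0 : p ≠ 0 := by
      intro h0
      apply hne
      ext α
      have : coeff α.1 p = l α := by
        rw [hp, Finsupp.sum, coeff_sum]
        simp only [coeff_monomial, Subtype.coe_inj]
        simp
        exact fun h => h.symm
      rw [← this, h0]
      simp
    have hpI : p ∈ Ideal.span (Set.range f) := by
      rw [← Ideal.Quotient.eq_zero_iff_mem, ← hl, hp, Finsupp.linearCombination_apply,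
        Finsupp.sum, Finsupp.sum, map_sum]
      refine Finset.sum_congr rfl fun α _ => ?_
      have : monomial α.1 (l α) = (l α) • monomial α.1 (1 : k) := by
        simp [smul_monomial]
      rw [this]
      exact map_smul (Ideal.Quotient.mkₐ k (Ideal.span (Set.range f))) _ _
    have hlead := (leadMon_spec μ p hp0).1
    rw [mem_support_iff] at hlead
    obtain ⟨α, -, hα⟩ := hcoeff _ hlead
    apply α.2
    have hmem : leadTerm μ p ∈ Ideal.span (Set.range fun i => leadTerm μ (f i)) := by
      have hG : _ = _ := hGB
      rw [← hG]
      exact Ideal.subset_span ⟨p, hpI, rfl⟩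
    have : monomial α.1 (1 : k) = C (coeff (leadMon μ p) p)⁻¹ * leadTerm μ p := by
      rw [leadTerm, C_mul_monomial, inv_mul_cancel₀ hlead, hα]
    rw [this]
    exact Ideal.mul_mem_left _ _ hmem
  · set S := Submodule.span k
      (Set.range (fun α : {α : Fin n →₀ ℕ // MvPolynomial.monomial α (1 : k) ∉
          Ideal.span (Set.range fun i => leadTerm μ (f i))} =>
        Ideal.Quotient.mk (Ideal.span (Set.range f))
          (MvPolynomial.monomial α.1 (1 : k)))) with hS
    have hpoly : ∀ h : MvPolynomial (Fin n) k,
        (∀ δ ∈ h.support, Ideal.Quotient.mk (Ideal.span (Set.range f)) (monomial δ (1 : k)) ∈ S) →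
        Ideal.Quotient.mk (Ideal.span (Set.range f)) h ∈ S := by
      intro h hh
      rw [h.as_sum, map_sum]
      refine Submodule.sum_mem _ fun δ hδ => ?_
      have : monomial δ (coeff δ h) = (coeff δ h) • monomial δ (1 : k) := by
        simp [smul_monomial]
      rw [this]
      have h2 := map_smul (Ideal.Quotient.mkₐ k (Ideal.span (Set.range f))) (coeff δ h)
        (monomial δ (1 : k))
      simp only [Ideal.Quotient.mkₐ_eq_mk] at h2
      rw [h2]
      exact Submodule.smul_mem _ _ (hh δ hδ)
    have hmon : ∀ α, Ideal.Quotient.mk (Ideal.span (Set.range f)) (monomial α (1 : k)) ∈ S := by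
      intro α
      induction α using μ.wf.induction with
      | _ α ih =>
      by_cases hα : monomial α (1 : k) ∈ Ideal.span (Set.range fun i => leadTerm μ (f i))
      · obtain ⟨i, hi⟩ := exists_le_of_mem μ f α hα
        obtain ⟨γ, hγ⟩ := exists_add_of_le hi
        obtain ⟨hl1, hl2⟩ := leadMon_spec μ (f i) (hf i)
        rw [mem_support_iff] at hl1
        set β := leadMon μ (f i)
        set q : MvPolynomial (Fin n) k := monomial γ (coeff β (f i))⁻¹ * f i with hq
        have hqI : Ideal.Quotient.mk (Ideal.span (Set.range f)) q = 0 :=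
          Ideal.Quotient.eq_zero_iff_mem.2
            (Ideal.mul_mem_left _ _ (Ideal.subset_span ⟨i, rfl⟩))
        have heq : Ideal.Quotient.mk (Ideal.span (Set.range f)) (monomial α (1 : k)) =
            Ideal.Quotient.mk (Ideal.span (Set.range f)) (monomial α (1 : k) - q) := by
          rw [map_sub, hqI, sub_zero]
        rw [heq]
        refine hpoly _ fun δ hδ => ih δ ?_
        rw [mem_support_iff, coeff_sub] at hδ
        have hδα : δ ≠ α := by
          rintro rfl
          apply hδ
          rw [hq, hγ, add_comm β γ, coeff_monomial_mul, inv_mul_cancel₀ hl1]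
          simp
        rw [coeff_monomial, if_neg (Ne.symm hδα), zero_sub, neg_ne_zero, hq,
          coeff_monomial_mul'] at hδ
        split_ifs at hδ with hle
        · obtain ⟨ε, rfl⟩ := exists_add_of_le hle
          rw [add_tsub_cancel_left] at hδ
          have := hl2 ε (mem_support_iff.2 (right_ne_zero_of_mul hδ))
            (by rintro rfl; exact hδα (by rw [hγ, add_comm]))
          have := μ.add_right _ _ γ this
          rwa [← hγ, add_comm] at this
        · exact absurd rfl hδ
      · exact Submodule.subset_span ⟨⟨α, hα⟩, rfl⟩
    rw [eq_top_iff]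
    rintro x -
    obtain ⟨p, rfl⟩ := Ideal.Quotient.mk_surjective x
    exact hpoly p fun δ _ => hmon δ
end

section
/- Let > be a global monomial order on R^{r₀} over R = k[x₁,...,xₙ], let F₁,...,F_{r₁} ∈ R^{r₀} be a Gröbner basis, and let ℓ be the maximal index k such that the variable x_k occurs in some leading term L(F_j). Suppose F₁,...,F_{r₁} are ordered so that whenever j < i, the exponent of x_ℓ in L(F_j) is less than or equal to the exponent of x_ℓ in L(F_i). Then none of the variables x_ℓ, x_{ℓ+1}, ..., xₙ occurs in any leading term L(G^{(i,α)}) = x^α eᵢ of the syzygies G^{(i,α)} obtained from Buchberger's criterion; equivalently, every minimal monomial generator x^α of Mᵢ := ⟨L(F₁),...,L(F_{i−1})⟩ : L(Fᵢ) involves only the variables x₁,...,x_{ℓ−1}. -/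
open MvPolynomial

variable {k : Type*} [Field k] {n : ℕ}

/-- Every term of an element of a submodule spanned by module terms is divisible by one of
the generating terms. -/
lemma exists_dvd_of_mem_span {r₀ r₁ : ℕ} (F : Fin r₁ → (Fin r₀ → MvPolynomial (Fin n) k))
    (LM : Fin r₁ → (Fin n →₀ ℕ) × Fin r₀) (i : Fin r₁) (v : Fin r₀ → MvPolynomial (Fin n) k)
    (hv : v ∈ Submodule.span (MvPolynomial (Fin n) k)
      {v | ∃ j, j < i ∧ v = leadTermV (F j) (LM j)}) :
    ∀ (c : Fin r₀) (γ : Fin n →₀ ℕ), coeff γ (v c) ≠ 0 →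
      ∃ j, j < i ∧ (LM j).2 = c ∧ (LM j).1 ≤ γ := by
  induction hv using Submodule.span_induction with
  | mem x hx =>
    obtain ⟨j, hj, rfl⟩ := hx
    intro c γ h
    unfold leadTermV vecTerm at h
    by_cases hc : (LM j).2 = c
    · subst hc
      rw [Pi.single_eq_same, coeff_monomial] at h
      refine ⟨j, hj, rfl, ?_⟩
      by_cases h' : (LM j).1 = γ
      · exact h'.le
      · simp [h'] at h
    · rw [Pi.single_eq_of_ne (Ne.symm hc)] at h
      simp at h
  | zero => intro c γ h; simp at h
  | add x y _ _ hx hy =>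
    intro c γ h
    by_cases h1 : coeff γ (x c) = 0
    · refine hy c γ fun h2 => h ?_
      simp [h1, h2]
    · exact hx c γ h1
  | smul a x _ hx =>
    intro c γ h
    rw [Pi.smul_apply, smul_eq_mul, coeff_mul] at h
    obtain ⟨p, hp, hne⟩ := Finset.exists_ne_zero_of_sum_ne_zero h
    obtain ⟨j, hj, hc, hle⟩ := hx c p.2 (right_ne_zero_of_mul hne)
    refine ⟨j, hj, hc, hle.trans ?_⟩
    rw [← Finset.HasAntidiagonal.mem_antidiagonal.mp hp]
    exact le_add_self

/-- Let `F₁,...,F_{r₁} ∈ R^{r₀}` be a Gröbner basis with leading monomials `LM`, and let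
`ℓ` be the maximal index such that `x_ℓ` occurs in some leading term `L(F_j)`. If the
`F_j` are ordered so that for `j < i` the exponent of `x_ℓ` in `L(F_j)` is at most that
in `L(F_i)`, then every minimal monomial generator `x^α` of
`Mᵢ = ⟨L(F₁),...,L(F_{i-1})⟩ : L(Fᵢ)` involves only the variables `x₁,...,x_{ℓ-1}`;
i.e., none of `x_ℓ,...,xₙ` occurs in any leading term `L(G^{(i,α)}) = x^α eᵢ`. -/
theorem syzygy_leading_terms_avoid_last_variables {r₀ r₁ : ℕ} (μ : VecMonomialOrd n r₀)
    (F : Fin r₁ → (Fin r₀ → MvPolynomial (Fin n) k)) (hF : ∀ i, F i ≠ 0)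
    (hGB : IsGroebnerV μ F)
    (LM : Fin r₁ → (Fin n →₀ ℕ) × Fin r₀) (hLM : ∀ i, IsLeadMonV μ.lt (F i) (LM i))
    (ℓ : Fin n)
    (hocc : ∃ j, (LM j).1 ℓ ≠ 0)
    (hmax : ∀ (j : Fin r₁) (m : Fin n), ℓ < m → (LM j).1 m = 0)
    (hsorted : ∀ i j : Fin r₁, j < i → (LM j).1 ℓ ≤ (LM i).1 ℓ) :
    ∀ (i : Fin r₁) (α : Fin n →₀ ℕ), IsMinGen (colonV F LM i) α →
      ∀ m : Fin n, ℓ ≤ m → α m = 0 := by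
  intro i α ⟨hα, hmin⟩ m hm
  have hne : ∀ j, coeff (LM j).1 (F j (LM j).2) ≠ 0 := fun j =>
    mem_support_iff.mp (hLM j).1
  have h1 := Submodule.mem_colon.mp hα _ (Submodule.subset_span (Set.mem_singleton _))
  obtain ⟨j, hj, hc, hle⟩ := exists_dvd_of_mem_span F LM i _ h1 (LM i).2 (α + (LM i).1) (by
    simpa [leadTermV, vecTerm, monomial_mul] using hne i)
  have hβα : (LM j).1 - (LM i).1 ≤ α := tsub_le_iff_right.mpr hle
  have hβ : monomial ((LM j).1 - (LM i).1) (1 : k) ∈ colonV F LM i := by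
    refine Submodule.mem_colon.mpr fun s hs => ?_
    obtain ⟨a, rfl⟩ := Submodule.mem_span_singleton.mp hs
    rw [smul_comm]
    refine Submodule.smul_mem _ _ ?_
    have key : monomial ((LM j).1 - (LM i).1) (1 : k) • leadTermV (F i) (LM i) =
        monomial ((LM i).1 - (LM j).1)
          (coeff (LM i).1 (F i (LM i).2) * (coeff (LM j).1 (F j (LM j).2))⁻¹) •
          leadTermV (F j) (LM j) := by
      unfold leadTermV vecTerm
      rw [← Pi.single_smul, ← Pi.single_smul, hc, smul_eq_mul, smul_eq_mul, monomial_mul,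
        monomial_mul, one_mul, ← hc, inv_mul_cancel_right₀ (hne j)]
      have he : (LM j).1 - (LM i).1 + (LM i).1 = (LM i).1 - (LM j).1 + (LM j).1 := by
        ext t
        simp only [Finsupp.add_apply, Finsupp.tsub_apply]
        omega
      rw [he]
    rw [key]
    exact Submodule.smul_mem _ _ (Submodule.subset_span ⟨j, hj, rfl⟩)
  have heq : (LM j).1 - (LM i).1 = α := by
    by_contra hcon
    exact hmin _ ⟨α - ((LM j).1 - (LM i).1), (add_tsub_cancel_of_le hβα).symm⟩ hcon hβ
  rw [← heq, Finsupp.tsub_apply]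
  rcases hm.eq_or_lt with rfl | hlt
  · exact Nat.sub_eq_zero_of_le (hsorted i j hj)
  · rw [hmax j m hlt, Nat.zero_sub]
end

section
/- Let > be a global monomial order on R = k[x₁,...,xₙ], let f₁,...,f_r ∈ R be nonzero polynomials, and set Mᵢ := ⟨L(f₁),...,L(f_{i−1})⟩ : L(fᵢ) for i = 1,...,r. Suppose g₁,...,g_r ∈ R are such that for each i, no term of gᵢ lies in the monomial ideal Mᵢ. Then the nonzero leading terms L(gᵢ)·L(fᵢ) involve pairwise distinct monomials, so no cancellation occurs among them; consequently, if not all gᵢ are zero, then g := g₁f₁ + ⋯ + g_rf_r ≠ 0 and L(g) = max_i { L(gᵢ)·L(fᵢ) }, which lies in ⟨L(f₁),...,L(f_r)⟩. -/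
open MvPolynomial

variable {k : Type*} [Field k] {n : ℕ}

theorem aux_exists_max {ι : Type*} (μ : MonomialOrd n) (s : Finset ι) (φ : ι → (Fin n →₀ ℕ))
    (hs : s.Nonempty) : ∃ i ∈ s, ∀ j ∈ s, φ j ≠ φ i → μ.lt (φ j) (φ i) := by
  classical
  induction hs using Finset.Nonempty.cons_induction with
  | singleton a => exact ⟨a, by simp, by simp⟩
  | cons a s ha hs ih =>
    obtain ⟨i, hi, him⟩ := ih
    by_cases h : μ.lt (φ i) (φ a)
    · refine ⟨a, by simp, fun j hj hne => ?_⟩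
      rcases Finset.mem_cons.1 hj with rfl | hj
      · exact absurd rfl hne
      · by_cases hji : φ j = φ i
        · rw [hji]; exact h
        · exact μ.lt_trans _ _ _ (him j hj hji) h
    · refine ⟨i, by simp [hi], fun j hj hne => ?_⟩
      rcases Finset.mem_cons.1 hj with rfl | hj
      · rcases μ.trichotomy (φ j) (φ i) with h1 | h1 | h1
        · exact h1
        · exact absurd h1 hne
        · exact absurd h1 h
      · exact him j hj hne

theorem aux_leadMon_spec (μ : MonomialOrd n) {f : MvPolynomial (Fin n) k} (hf : f ≠ 0) :
    IsLeadMon μ f (leadMon μ f) := by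
  have h : ∃ β, IsLeadMon μ f β := by
    obtain ⟨i, hi, h⟩ := aux_exists_max μ f.support id (by simpa using hf)
    exact ⟨i, hi, h⟩
  unfold leadMon
  rw [dif_pos h]
  exact h.choose_spec

theorem aux_leadMon_eq (μ : MonomialOrd n) {f : MvPolynomial (Fin n) k} {β : Fin n →₀ ℕ}
    (h : IsLeadMon μ f β) : leadMon μ f = β := by
  have hf : f ≠ 0 := by
    rintro rfl
    simpa using h.1
  have h' := aux_leadMon_spec μ hf
  by_contra hne
  exact μ.lt_irrefl _ (μ.lt_trans _ _ _ (h.2 _ h'.1 hne) (h'.2 _ h.1 (Ne.symm hne)))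

theorem aux_add_lt (μ : MonomialOrd n) {a b c d : Fin n →₀ ℕ} (h1 : c ≠ a → μ.lt c a)
    (h2 : d ≠ b → μ.lt d b) (h : ¬ (c = a ∧ d = b)) : μ.lt (c + d) (a + b) := by
  by_cases hc : c = a
  · subst hc
    have := μ.add_right _ _ c (h2 (fun hd => h ⟨rfl, hd⟩))
    rwa [add_comm d, add_comm b] at this
  · have h3 := μ.add_right _ _ d (h1 hc)
    by_cases hd : d = b
    · subst hd; exact h3
    · have := μ.add_right _ _ a (h2 hd)
      rw [add_comm d, add_comm b] at this
      exact μ.lt_trans _ _ _ h3 this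

theorem aux_coeff_mul (μ : MonomialOrd n) {f g : MvPolynomial (Fin n) k} {a b : Fin n →₀ ℕ}
    (ha : IsLeadMon μ f a) (hb : IsLeadMon μ g b) :
    coeff (a + b) (f * g) = coeff a f * coeff b g := by
  classical
  rw [coeff_mul, Finset.sum_eq_single (a, b)]
  · rintro ⟨c, d⟩ hcd hne
    by_contra h
    have hc : c ∈ f.support := by
      rw [mem_support_iff]; intro h0; simp [h0] at h
    have hd : d ∈ g.support := by
      rw [mem_support_iff]; intro h0; simp [h0] at h
    have hlt := aux_add_lt μ (ha.2 c hc) (hb.2 d hd) (by simpa using hne)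
    rw [Finset.HasAntidiagonal.mem_antidiagonal.1 hcd] at hlt
    exact μ.lt_irrefl _ hlt
  · simp

theorem aux_mul_lead (μ : MonomialOrd n) {f g : MvPolynomial (Fin n) k} {a b : Fin n →₀ ℕ}
    (ha : IsLeadMon μ f a) (hb : IsLeadMon μ g b) : IsLeadMon μ (f * g) (a + b) := by
  classical
  constructor
  · rw [mem_support_iff, aux_coeff_mul μ ha hb]
    exact mul_ne_zero (mem_support_iff.1 ha.1) (mem_support_iff.1 hb.1)
  · intro γ hγ hne
    obtain ⟨c, hc, d, hd, rfl⟩ := Finset.mem_add.1 (support_mul f g hγ)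
    exact aux_add_lt μ (ha.2 c hc) (hb.2 d hd) (by rintro ⟨rfl, rfl⟩; exact hne rfl)

theorem aux_ne (μ : MonomialOrd n) {r : ℕ}
    (f g : Fin r → MvPolynomial (Fin n) k) (hf : ∀ i, f i ≠ 0)
    (hg : ∀ i : Fin r, ∀ γ ∈ (g i).support,
      MvPolynomial.monomial γ (1 : k) ∉ colonIdeal μ f i) (i j : Fin r) (hi : g i ≠ 0)
    (hij : j < i) :
      leadMon μ (g i) + leadMon μ (f i) ≠ leadMon μ (g j) + leadMon μ (f j) := by
  intro h
  apply hg i _ (aux_leadMon_spec μ hi).1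
  have hc : coeff (leadMon μ (f j)) (f j) ≠ 0 := mem_support_iff.1 (aux_leadMon_spec μ (hf j)).1
  unfold colonIdeal
  rw [Submodule.mem_colon]
  intro p hp
  obtain ⟨q, rfl⟩ := Ideal.mem_span_singleton'.1 hp
  have key : monomial (leadMon μ (g i)) (1 : k) * leadTerm μ (f i) =
      monomial (leadMon μ (g j)) (coeff (leadMon μ (f i)) (f i) / coeff (leadMon μ (f j)) (f j))
        * leadTerm μ (f j) := by
    simp only [leadTerm, monomial_mul, h, one_mul, div_mul_cancel₀ _ hc]
  rw [smul_eq_mul, mul_left_comm, key]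
  exact Ideal.mul_mem_left _ _ (Ideal.mul_mem_left _ _ (Ideal.subset_span ⟨j, hij, rfl⟩))

/-- If no term of `gᵢ` lies in `Mᵢ = ⟨L(f₁),...,L(f_{i-1})⟩ : L(fᵢ)`, then the nonzero
leading terms `L(gᵢ)·L(fᵢ)` involve pairwise distinct monomials; consequently, if not
all `gᵢ` are zero, then `g = g₁f₁ + ⋯ + g_rf_r ≠ 0` and
`L(g) = maxᵢ {L(gᵢ)·L(fᵢ)} ∈ ⟨L(f₁),...,L(f_r)⟩`. -/
theorem no_cancellation_of_leading_terms (μ : MonomialOrd n) {r : ℕ}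
    (f g : Fin r → MvPolynomial (Fin n) k) (hf : ∀ i, f i ≠ 0)
    (hg : ∀ i : Fin r, ∀ γ ∈ (g i).support,
      MvPolynomial.monomial γ (1 : k) ∉ colonIdeal μ f i) :
    (∀ i j : Fin r, g i ≠ 0 → g j ≠ 0 → i ≠ j →
      leadMon μ (g i) + leadMon μ (f i) ≠ leadMon μ (g j) + leadMon μ (f j)) ∧
    ((∃ i, g i ≠ 0) →
      (∑ i, g i * f i) ≠ 0 ∧
      ∃ i, g i ≠ 0 ∧
        IsLeadMon μ (∑ j, g j * f j) (leadMon μ (g i) + leadMon μ (f i)) ∧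
        (∀ j, g j ≠ 0 → j ≠ i →
          μ.lt (leadMon μ (g j) + leadMon μ (f j)) (leadMon μ (g i) + leadMon μ (f i))) ∧
        leadTerm μ (∑ j, g j * f j) = leadTerm μ (g i) * leadTerm μ (f i) ∧
        leadTerm μ (∑ j, g j * f j) ∈
          Ideal.span (Set.range fun j => leadTerm μ (f j))) := by
  classical
  have hdist : ∀ i j : Fin r, g i ≠ 0 → g j ≠ 0 → i ≠ j →
      leadMon μ (g i) + leadMon μ (f i) ≠ leadMon μ (g j) + leadMon μ (f j) := by
    intro i j hi hj hij
    rcases lt_or_gt_of_ne hij with h | h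
    · exact (aux_ne μ f g hf hg j i hj h).symm
    · exact aux_ne μ f g hf hg i j hi h
  refine ⟨hdist, ?_⟩
  rintro ⟨i₀, hi₀⟩
  obtain ⟨i, hi, hmax⟩ := aux_exists_max μ (Finset.univ.filter fun i => g i ≠ 0)
    (fun i => leadMon μ (g i) + leadMon μ (f i)) ⟨i₀, by simpa using hi₀⟩
  have hi : g i ≠ 0 := by simpa using hi
  have hlt : ∀ j, g j ≠ 0 → j ≠ i →
      μ.lt (leadMon μ (g j) + leadMon μ (f j)) (leadMon μ (g i) + leadMon μ (f i)) :=
    fun j hj hji => hmax j (by simpa using hj) (hdist j i hj hi hji)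
  have hprod : ∀ j, g j ≠ 0 →
      IsLeadMon μ (g j * f j) (leadMon μ (g j) + leadMon μ (f j)) := fun j hj =>
    aux_mul_lead μ (aux_leadMon_spec μ hj) (aux_leadMon_spec μ (hf j))
  have hother : ∀ j, j ≠ i → ∀ γ ∈ (g j * f j).support,
      μ.lt γ (leadMon μ (g i) + leadMon μ (f i)) := by
    intro j hji γ hγ
    have hj : g j ≠ 0 := by
      intro h0
      simp [h0] at hγ
    by_cases hγ' : γ = leadMon μ (g j) + leadMon μ (f j)
    · rw [hγ']; exact hlt j hj hji
    · exact μ.lt_trans _ _ _ ((hprod j hj).2 γ hγ hγ') (hlt j hj hji)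
  have hcoeff : coeff (leadMon μ (g i) + leadMon μ (f i)) (∑ j, g j * f j) =
      coeff (leadMon μ (g i)) (g i) * coeff (leadMon μ (f i)) (f i) := by
    rw [coeff_sum, Finset.sum_eq_single i]
    · exact aux_coeff_mul μ (aux_leadMon_spec μ hi) (aux_leadMon_spec μ (hf i))
    · intro j _ hji
      by_contra h
      exact μ.lt_irrefl _ (hother j hji _ (mem_support_iff.2 h))
    · simp
  have hlead : IsLeadMon μ (∑ j, g j * f j) (leadMon μ (g i) + leadMon μ (f i)) := by
    constructor
    · rw [mem_support_iff, hcoeff]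
      exact mul_ne_zero (mem_support_iff.1 (aux_leadMon_spec μ hi).1)
        (mem_support_iff.1 (aux_leadMon_spec μ (hf i)).1)
    · intro γ hγ hne
      rw [mem_support_iff, coeff_sum] at hγ
      obtain ⟨j, _, hj⟩ := Finset.exists_ne_zero_of_sum_ne_zero hγ
      by_cases hji : j = i
      · subst hji
        exact (hprod j hi).2 γ (mem_support_iff.2 hj) hne
      · exact hother j hji γ (mem_support_iff.2 hj)
  have hLT : leadTerm μ (∑ j, g j * f j) = leadTerm μ (g i) * leadTerm μ (f i) := by
    unfold leadTerm
    rw [aux_leadMon_eq μ hlead, hcoeff, monomial_mul]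
  refine ⟨?_, i, hi, hlead, hlt, hLT, ?_⟩
  · intro h0
    have := hlead.1
    rw [h0] at this
    simp at this
  · rw [hLT]
    exact Ideal.mul_mem_left _ _ (Ideal.subset_span ⟨i, rfl⟩)
end
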